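/- Let G be a finite connected subcubic simple graph on n vertices and m edges such that G is triangle-free, G does not contain two vertex-disjoint cycles each of length less than five, and G contains no induced subdivision of any member of the family 𝓕. Then φ(G) ≤ (2m − n + 4)/7. -/

import Mathlib

open SimpleGraph

/-- The minimum size of a feedback vertex set of `G`. -/
noncomputable def phi {V : Type} (G : SimpleGraph V) : ℕ :=
  sInf {n : ℕ | ∃ S : Finset V, S.card = n ∧ (G.induce ((S : Set V)ᶜ)).IsAcyclic}

/-- The graph obtained from `H` by subdividing the edge `uv` once: delete the edge `uv`
and add a new vertex (`none`) adjacent exactly to `u` and `v`. -/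
def subdivideEdge {V : Type} (H : SimpleGraph V) (u v : V) : SimpleGraph (Option V) :=
  SimpleGraph.fromRel (fun x y =>
    (∃ p q : V, x = some p ∧ y = some q ∧ H.Adj p q ∧ s(p, q) ≠ s(u, v)) ∨
    (x = none ∧ (y = some u ∨ y = some v)))

/-- `a` has degree exactly two in `H`. -/
def HasDegreeTwo {V : Type} (H : SimpleGraph V) (a : V) : Prop :=
  ∃ x y : V, x ≠ y ∧ H.Adj a x ∧ H.Adj a y ∧ ∀ z : V, H.Adj a z → z = x ∨ z = y

/-- The operation `∘` applied with two distinct edges `u₁v₁`, `u₂v₂` and a degree-two vertex `a`: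
subdivide both edges (new vertices `inr 0`, `inr 1`), then add a new vertex `inr 2` adjacent to
`a` and the two subdivision vertices. -/
def circOpTwo {V : Type} (H : SimpleGraph V) (u₁ v₁ u₂ v₂ a : V) : SimpleGraph (V ⊕ Fin 3) :=
  SimpleGraph.fromRel (fun x y =>
    (∃ p q : V, x = Sum.inl p ∧ y = Sum.inl q ∧ H.Adj p q ∧
      s(p, q) ≠ s(u₁, v₁) ∧ s(p, q) ≠ s(u₂, v₂)) ∨
    (x = Sum.inr 0 ∧ (y = Sum.inl u₁ ∨ y = Sum.inl v₁)) ∨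
    (x = Sum.inr 1 ∧ (y = Sum.inl u₂ ∨ y = Sum.inl v₂)) ∨
    (x = Sum.inr 2 ∧ (y = Sum.inl a ∨ y = Sum.inr 0 ∨ y = Sum.inr 1)))

/-- The operation `∘` applied with `e₁ = e₂ = uv` and a degree-two vertex `a`: subdivide the
edge `uv` twice (replacing it by the path `u, inr 0, inr 1, v`), then add a new vertex `inr 2`
adjacent to `a` and the two subdivision vertices. -/
def circOpOne {V : Type} (H : SimpleGraph V) (u v a : V) : SimpleGraph (V ⊕ Fin 3) :=
  SimpleGraph.fromRel (fun x y =>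
    (∃ p q : V, x = Sum.inl p ∧ y = Sum.inl q ∧ H.Adj p q ∧ s(p, q) ≠ s(u, v)) ∨
    (x = Sum.inr 0 ∧ (y = Sum.inl u ∨ y = Sum.inr 1)) ∨
    (x = Sum.inr 1 ∧ y = Sum.inl v) ∨
    (x = Sum.inr 2 ∧ (y = Sum.inl a ∨ y = Sum.inr 0 ∨ y = Sum.inr 1)))

/-- `G` is obtained from `H` by one application of the operation `∘` at the degree-two
vertex `a`, using two (not necessarily distinct) edges of `H`. -/
def IsCircOp {V : Type} (H : SimpleGraph V) (a : V) (G : SimpleGraph (V ⊕ Fin 3)) : Prop :=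
  (∃ u₁ v₁ u₂ v₂ : V, H.Adj u₁ v₁ ∧ H.Adj u₂ v₂ ∧ s(u₁, v₁) ≠ s(u₂, v₂) ∧
      G = circOpTwo H u₁ v₁ u₂ v₂ a) ∨
  (∃ u v : V, H.Adj u v ∧ G = circOpOne H u v a)

/-- Membership (up to isomorphism) in the family `F_{i,j}`. -/
inductive IsInF : ∀ (i j : ℕ) {V : Type}, SimpleGraph V → Prop
  | cycle (i : ℕ) (hi : 3 ≤ i) : IsInF i 0 (SimpleGraph.cycleGraph i)
  | k4 : IsInF 1 1 (⊤ : SimpleGraph (Fin 4))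
  | subdiv {i j : ℕ} {V : Type} {H : SimpleGraph V} {u v : V}
      (huv : H.Adj u v) (hH : IsInF i j H) : IsInF (i + 1) j (subdivideEdge H u v)
  | op {i j : ℕ} {V : Type} {H : SimpleGraph V} {a : V} {G : SimpleGraph (V ⊕ Fin 3)}
      (ha : HasDegreeTwo H a) (hG : IsCircOp H a G) (hH : IsInF i j H) : IsInF i (j + 1) G
  | iso {i j : ℕ} {V W : Type} {H : SimpleGraph V} {G : SimpleGraph W}
      (e : Nonempty (G ≃g H)) (hH : IsInF i j H) : IsInF i j G

/-- `G` is a graph obtained from `H` by repeatedly (possibly zero times) subdividing edges. -/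
inductive IsSubdivisionOf : ∀ {V : Type}, SimpleGraph V → ∀ {W : Type}, SimpleGraph W → Prop
  | refl {V : Type} (G : SimpleGraph V) : IsSubdivisionOf G G
  | step {V W : Type} {H : SimpleGraph V} {G : SimpleGraph W} {u v : W}
      (huv : G.Adj u v) (h : IsSubdivisionOf H G) : IsSubdivisionOf H (subdivideEdge G u v)

/-- `G` contains an induced subdivision of `H`: some induced subgraph of `G` is isomorphic
to a graph obtained from `H` by repeatedly subdividing edges. -/
def ContainsInducedSubdivision {V W : Type} (G : SimpleGraph V) (H : SimpleGraph W) : Prop :=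
  ∃ (s : Set V) (U : Type) (K : SimpleGraph U),
    IsSubdivisionOf H K ∧ Nonempty (G.induce s ≃g K)

/-- The family `𝓕`: members of `F_{4,2} ∪ F_{4,3}` of girth at least five, together with
members `H` of `F_{3,2} ∪ F_{3,3}` having an edge `e` such that `H − e` has girth at least
five. -/
def InFamilyF {W : Type} (H : SimpleGraph W) : Prop :=
  ((IsInF 4 2 H ∨ IsInF 4 3 H) ∧ 5 ≤ H.girth) ∨
  ((IsInF 3 2 H ∨ IsInF 3 3 H) ∧ ∃ e ∈ H.edgeSet, 5 ≤ (H.deleteEdges {e}).girth)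

/-- `G` contains two vertex-disjoint cycles, each of length less than five. -/
def HasTwoDisjointShortCycles {V : Type} (G : SimpleGraph V) : Prop :=
  ∃ (u v : V) (c₁ : G.Walk u u) (c₂ : G.Walk v v), c₁.IsCycle ∧ c₂.IsCycle ∧
    c₁.length < 5 ∧ c₂.length < 5 ∧ ∀ x : V, x ∈ c₁.support → x ∉ c₂.support

open Module Submodule in
theorem finrank_sup_span_le {K U : Type} [Field K] [AddCommGroup U] [Module K U]
    [FiniteDimensional K U] (P : Submodule K U) (x : U) :
    finrank K ↥(P ⊔ span K {x}) ≤ finrank K P + 1 := by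
  have h := Submodule.finrank_add_le_finrank_add_finrank P (span K {x})
  have h2 := finrank_span_le_card (R := K) ({x} : Set U)
  simp at h2
  omega

open Module Submodule in
theorem finrank_sup_span_of_notMem {K U : Type} [Field K] [AddCommGroup U] [Module K U]
    [FiniteDimensional K U] (P : Submodule K U) (x : U) (hx : x ∉ P) :
    finrank K ↥(P ⊔ span K {x}) = finrank K P + 1 := by
  refine le_antisymm (finrank_sup_span_le P x) ?_
  apply Submodule.finrank_lt_finrank_of_lt
  refine lt_of_le_of_ne le_sup_left ?_
  intro h
  apply hx
  rw [h]
  exact mem_sup_right (mem_span_singleton_self x)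

open Module Submodule in
theorem finrank_sup_L_le {K U W : Type} [Field K] [AddCommGroup U] [Module K U]
    [FiniteDimensional K U] (L : W → Submodule K U)
    (hL : ∀ w, finrank K (L w) ≤ 2) (X : Finset W) : finrank K ↥(X.sup L) ≤ 2 * X.card := by
  classical
  induction X using Finset.induction_on with
  | empty => simp
  | insert a s ha ih =>
    rw [Finset.sup_insert, Finset.card_insert_of_notMem ha]
    have h := Submodule.finrank_add_le_finrank_add_finrank (L a) (s.sup L)
    have := hL a
    omega

open Module Submodule in
/-- The exchange step. -/
theorem exchange_step {K U W : Type} [Field K] [AddCommGroup U] [Module K U]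
    [FiniteDimensional K U] [DecidableEq W] (L : W → Submodule K U)
    (hL : ∀ w, finrank K (L w) ≤ 2) (X Y : Finset W) (x : W) (hxX : x ∈ X) (hxY : x ∉ Y)
    (hX : finrank K ↥(X.sup L) = 2 * X.card) 
    (hYx : finrank K ↥((insert x Y).sup L) = 2 * Y.card + 1) :
    ∃ y ∈ Y, y ∉ X ∧ finrank K ↥((insert x (Y.erase y)).sup L) = 2 * Y.card := by
  by_contra hcon
  push Not at hcon
  have hdisj : ∀ y ∈ Y, y ∉ X → Disjoint ((insert x (Y.erase y)).sup L) (L y) ∧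
      finrank K (L y) = 2 := by
    intro y hy hyX
    have h1 := hcon y hy hyX
    have h2 := finrank_sup_L_le L hL (insert x (Y.erase y))
    have hc : (insert x (Y.erase y)).card = Y.card := by
      rw [Finset.card_insert_of_notMem (by simp [hxY]), Finset.card_erase_of_mem hy]
      have := Finset.card_pos.mpr ⟨y, hy⟩
      omega
    rw [hc] at h2
    have h3 := Submodule.finrank_sup_add_finrank_inf_eq ((insert x (Y.erase y)).sup L) (L y)
    have h4 : (insert x (Y.erase y)).sup L ⊔ L y = (insert x Y).sup L := by
      rw [sup_comm, ← Finset.sup_insert, Finset.insert_comm, Finset.insert_erase hy]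
    rw [h4, hYx] at h3
    have h5 := hL y
    have h6 : finrank K ↥((insert x (Y.erase y)).sup L ⊓ L y) = 0 := by omega
    refine ⟨?_, by omega⟩
    rw [disjoint_iff]
    exact Submodule.finrank_eq_zero.mp h6
  -- rank of a subset of X is full
  have hsub : finrank K ↥((insert x (Y ∩ X)).sup L) = 2 * (insert x (Y ∩ X)).card := by
    refine le_antisymm (finrank_sup_L_le L hL _) ?_
    have hs : insert x (Y ∩ X) ⊆ X := by
      intro z hz
      simp only [Finset.mem_insert, Finset.mem_inter] at hz
      rcases hz with rfl | h
      · exact hxX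
      · exact h.2
    have h1 := Submodule.finrank_add_le_finrank_add_finrank ((insert x (Y ∩ X)).sup L)
      ((X \ insert x (Y ∩ X)).sup L)
    rw [← Finset.sup_union, Finset.union_sdiff_of_subset hs, hX] at h1
    have h2 := finrank_sup_L_le L hL (X \ insert x (Y ∩ X))
    rw [Finset.card_sdiff_of_subset hs] at h2
    have := Finset.card_le_card hs
    omega
  have key : ∀ T : Finset W, T ⊆ Y \ X →
      finrank K ↥((insert x (Y ∩ X) ∪ T).sup L) = 2 * (insert x (Y ∩ X)).card + 2 * T.card := by
    intro T
    induction T using Finset.induction_on with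
    | empty => intro _; rw [Finset.union_empty, hsub, Finset.card_empty, Nat.mul_zero, Nat.add_zero]
    | insert y T hy ih =>
      intro hT
      have hyY : y ∈ Y \ X := hT (Finset.mem_insert_self _ _)
      rw [Finset.mem_sdiff] at hyY
      have ih' := ih (fun z hz => hT (Finset.mem_insert_of_mem hz))
      obtain ⟨hd, hr⟩ := hdisj y hyY.1 hyY.2
      have hle : (insert x (Y ∩ X) ∪ T).sup L ≤ (insert x (Y.erase y)).sup L := by
        apply Finset.sup_mono
        intro z hz
        have hTz : z ∈ T → z ∈ Y := fun h =>
          (Finset.mem_sdiff.mp (hT (Finset.mem_insert_of_mem h))).1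
        simp only [Finset.mem_union, Finset.mem_insert, Finset.mem_inter, Finset.mem_erase] at hz ⊢
        rcases hz with (h | h) | h
        · exact Or.inl h
        · right; refine ⟨?_, h.1⟩; rintro rfl; exact hyY.2 h.2
        · right; refine ⟨?_, hTz h⟩; rintro rfl; exact hy h
      have hd' := hd.mono_left hle
      have h3 := Submodule.finrank_sup_add_finrank_inf_eq ((insert x (Y ∩ X) ∪ T).sup L) (L y)
      rw [disjoint_iff.mp hd', finrank_bot] at h3
      rw [Finset.union_insert, Finset.sup_insert, sup_comm, Finset.card_insert_of_notMem hy]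
      omega
  have h1 := key (Y \ X) (Finset.Subset.refl _)
  have h2 : insert x (Y ∩ X) ∪ Y \ X = insert x Y := by
    ext z
    simp only [Finset.mem_union, Finset.mem_insert, Finset.mem_inter, Finset.mem_sdiff]
    tauto
  rw [h2, hYx, Finset.card_insert_of_notMem (by simp [hxY])] at h1
  have h3 := Finset.card_inter_add_card_sdiff Y X
  omega

open Module Submodule in
theorem gallai_trans {K U E W : Type} [Field K] [AddCommGroup U] [Module K U]
    [FiniteDimensional K U] [DecidableEq W] (φ : E → U) (L : W → Submodule K U)
    (hL : ∀ w, finrank K (L w) ≤ 2) (ν : ℕ)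
    (hmax : ∀ X : Finset W, finrank K ↥(X.sup L) = 2 * X.card → X.card ≤ ν)
    (e f g : E) (X : Finset W) (hXc : X.card = ν) (hX : finrank K ↥(X.sup L) = 2 * ν)
    (hef : finrank K ↥(X.sup L ⊔ span K {φ e} ⊔ span K {φ f}) = 2 * ν + 2)
    (hY : ∃ Y : Finset W, Y.card = ν ∧ finrank K ↥(Y.sup L) = 2 * ν ∧ φ g ∉ Y.sup L) :
    ∃ Y : Finset W, Y.card = ν ∧ finrank K ↥(Y.sup L) = 2 * ν ∧
      (finrank K ↥(Y.sup L ⊔ span K {φ e} ⊔ span K {φ g}) = 2 * ν + 2 ∨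
       finrank K ↥(Y.sup L ⊔ span K {φ g} ⊔ span K {φ f}) = 2 * ν + 2) := by
  by_contra hcon
  push Not at hcon
  -- choose Y with maximal intersection
  obtain ⟨Y, ⟨hYc, hYr, hYg⟩, hYm⟩ : ∃ Y : Finset W,
      (Y.card = ν ∧ finrank K ↥(Y.sup L) = 2 * ν ∧ φ g ∉ Y.sup L) ∧
      ∀ Y' : Finset W, (Y'.card = ν ∧ finrank K ↥(Y'.sup L) = 2 * ν ∧ φ g ∉ Y'.sup L) →
        (X ∩ Y').card ≤ (X ∩ Y).card := by
    let s : Set ℕ := {k | ∃ Y : Finset W,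
      (Y.card = ν ∧ finrank K ↥(Y.sup L) = 2 * ν ∧ φ g ∉ Y.sup L) ∧ (X ∩ Y).card = k}
    have hne : s.Nonempty := by
      obtain ⟨Y, h⟩ := hY
      exact ⟨_, Y, h, rfl⟩
    have hbd : BddAbove s := by
      refine ⟨X.card, ?_⟩
      rintro k ⟨Y, _, rfl⟩
      exact Finset.card_le_card Finset.inter_subset_left
    obtain ⟨Y, h, hk⟩ := Nat.sSup_mem hne hbd
    refine ⟨Y, h, ?_⟩
    intro Y' h'
    rw [hk]
    exact le_csSup hbd ⟨Y', h', rfl⟩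
  set Q := Y.sup L ⊔ span K {φ g} with hQ
  have hQr : finrank K Q = 2 * ν + 1 := by
    rw [hQ, finrank_sup_span_of_notMem _ _ hYg, hYr]
  obtain ⟨hc1, hc2⟩ := hcon Y hYc hYr
  have he : φ e ∈ Q := by
    by_contra h
    apply hc1
    rw [sup_assoc, sup_comm (span K {φ e}), ← sup_assoc, ← hQ, finrank_sup_span_of_notMem _ _ h, hQr]
  have hf : φ f ∈ Q := by
    by_contra h
    apply hc2
    rw [← hQ, finrank_sup_span_of_notMem _ _ h, hQr]
  have hXQ : X.sup L ≤ Q := by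
    apply Finset.sup_le
    intro x hx
    by_cases hxY : x ∈ Y
    · exact le_trans (Finset.le_sup (f := L) hxY) le_sup_left
    by_contra hxQ
    -- rank of insert x Y
    have hins : (insert x Y).sup L = L x ⊔ Y.sup L := Finset.sup_insert
    have hr2 := finrank_sup_L_le L hL (insert x Y)
    have hcard : (insert x Y).card = ν + 1 := by rw [Finset.card_insert_of_notMem hxY, hYc]
    have hne : finrank K ↥((insert x Y).sup L) ≠ 2 * (insert x Y).card := by
      intro h
      have := hmax _ h
      omega
    have hgt : finrank K ↥(Y.sup L) < finrank K ↥((insert x Y).sup L) := by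
      apply Submodule.finrank_lt_finrank_of_lt
      rw [hins]
      refine lt_of_le_of_ne le_sup_right ?_
      intro h
      apply hxQ
      exact le_trans (le_trans le_sup_left (le_of_eq h.symm)) le_sup_left
    have hr : finrank K ↥((insert x Y).sup L) = 2 * Y.card + 1 := by omega
    have hg : φ g ∉ (insert x Y).sup L := by
      intro hg
      have hle : Q ≤ (insert x Y).sup L := by
        rw [hQ, hins]
        apply sup_le le_sup_right
        rw [span_le, Set.singleton_subset_iff, ← hins]
        exact hg
      have : Q = (insert x Y).sup L := by
        apply Submodule.eq_of_le_of_finrank_eq hle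
        rw [hQr, hr, hYc]
      apply hxQ
      rw [this, hins]
      exact le_sup_left
    obtain ⟨y, hyY, hyX, hy⟩ := exchange_step L hL X Y x hx hxY (by rw [hX, hXc]) hr
    have hc : (insert x (Y.erase y)).card = ν := by
      rw [Finset.card_insert_of_notMem (by simp [hxY]), Finset.card_erase_of_mem hyY]
      have := Finset.card_pos.mpr ⟨y, hyY⟩
      omega
    have hm := hYm (insert x (Y.erase y)) ⟨hc, by rw [hy, hYc], ?_⟩
    · have hlt : (X ∩ Y).card < (X ∩ insert x (Y.erase y)).card := by
        apply Finset.card_lt_card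
        rw [Finset.ssubset_iff_of_subset]
        · exact ⟨x, by simp [hx], by simp [hxY]⟩
        · intro z hz
          simp only [Finset.mem_inter, Finset.mem_insert, Finset.mem_erase] at hz ⊢
          refine ⟨hz.1, Or.inr ⟨?_, hz.2⟩⟩
          rintro rfl
          exact hyX hz.1
      omega
    · intro h
      apply hg
      have hle : (insert x (Y.erase y)).sup L ≤ (insert x Y).sup L :=
        Finset.sup_mono (Finset.insert_subset_insert _ (Finset.erase_subset _ _))
      exact hle h
  have hle : X.sup L ⊔ span K {φ e} ⊔ span K {φ f} ≤ Q := by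
    refine sup_le (sup_le hXQ ?_) ?_
    · rwa [span_le, Set.singleton_subset_iff]
    · rwa [span_le, Set.singleton_subset_iff]
  have := Submodule.finrank_mono hle
  omega

open Module Submodule in
theorem gallai {K U E W : Type} [Field K] [AddCommGroup U] [Module K U]
    [FiniteDimensional K U] [DecidableEq W] (φ : E → U) (L : W → Submodule K U)
    (inc : W → Set E) (hinc : ∀ w, ∀ e ∈ inc w, φ e ∈ L w)
    (hL : ∀ w, finrank K (L w) ≤ 2) (hspan : span K (Set.range φ) = ⊤) (ν : ℕ)
    (hmax : ∀ X : Finset W, finrank K ↥(X.sup L) = 2 * X.card → X.card ≤ ν)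
    (hmiss : ∀ e, ∃ Y : Finset W, Y.card = ν ∧ finrank K ↥(Y.sup L) = 2 * ν ∧ φ e ∉ Y.sup L)
    (hconn : ∀ e f, Relation.ReflTransGen (fun e f => ∃ w, e ∈ inc w ∧ f ∈ inc w) e f) :
    finrank K U ≤ 2 * ν + 1 := by
  by_contra hlt
  push Not at hlt
  have hex : ∀ P : Submodule K U, finrank K P < finrank K U → ∃ e, φ e ∉ P := by
    intro P hP
    by_contra h
    push Not at h
    have : P = ⊤ := by
      rw [eq_top_iff, ← hspan, span_le]
      rintro _ ⟨e, rfl⟩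
      exact h e
    rw [this, finrank_top] at hP
    omega
  obtain ⟨e₀, -⟩ := hex ⊥ (by rw [finrank_bot]; omega)
  obtain ⟨X, hXc, hX, -⟩ := hmiss e₀
  obtain ⟨e, he⟩ := hex (X.sup L) (by omega)
  obtain ⟨f, hf⟩ := hex (X.sup L ⊔ span K {φ e}) (by
    rw [finrank_sup_span_of_notMem _ _ he]; omega)
  have hD : ∃ Y : Finset W, Y.card = ν ∧ finrank K ↥(Y.sup L) = 2 * ν ∧
      finrank K ↥(Y.sup L ⊔ span K {φ e} ⊔ span K {φ f}) = 2 * ν + 2 := by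
    refine ⟨X, hXc, hX, ?_⟩
    rw [finrank_sup_span_of_notMem _ _ hf, finrank_sup_span_of_notMem _ _ he, hX]
  have hN : ∀ f, ¬ ∃ Y : Finset W, Y.card = ν ∧ finrank K ↥(Y.sup L) = 2 * ν ∧
      finrank K ↥(Y.sup L ⊔ span K {φ e} ⊔ span K {φ f}) = 2 * ν + 2 := by
    intro f
    induction hconn e f with
    | refl =>
      rintro ⟨Y, h1, h2, h3⟩
      rw [sup_assoc, sup_idem] at h3
      have := finrank_sup_span_le (Y.sup L) (φ e)
      omega
    | @tail g f _ hgf ih =>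
      rintro ⟨Y, h1, h2, h3⟩
      obtain ⟨Y', h1', h2', h3'⟩ := gallai_trans φ L hL ν hmax e f g Y h1 h2 h3 (hmiss g)
      rcases h3' with h3' | h3'
      · exact ih ⟨Y', h1', h2', h3'⟩
      · obtain ⟨w, hg, hf⟩ := hgf
        have hle : Y'.sup L ⊔ span K {φ g} ⊔ span K {φ f} ≤ (insert w Y').sup L := by
          rw [Finset.sup_insert]
          refine sup_le (sup_le le_sup_right ?_) ?_
          · rw [span_le, Set.singleton_subset_iff]; exact mem_sup_left (hinc w g hg)
          · rw [span_le, Set.singleton_subset_iff]; exact mem_sup_left (hinc w f hf)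
        have h4 := Submodule.finrank_mono hle
        have h5 := finrank_sup_L_le L hL (insert w Y')
        have h6 := Finset.card_insert_le w Y'
        have h7 := hmax (insert w Y') (by omega)
        omega
  exact hN f hD

/-! ### Cycle space over `ZMod 2` -/

/-- boundary map -/
def bd (V : Type) [Fintype V] : (Sym2 V → ZMod 2) →ₗ[ZMod 2] (V → ZMod 2) where
  toFun c v := ∑ u, c s(v, u)
  map_add' a b := by ext v; simp [Finset.sum_add_distrib]
  map_smul' r a := by ext v; simp [Finset.mul_sum]

/-- chains supported on the edges of `H` -/
def chains {V : Type} (H : SimpleGraph V) : Submodule (ZMod 2) (Sym2 V → ZMod 2) where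
  carrier := {c | ∀ e, e ∉ H.edgeSet → c e = 0}
  add_mem' := by intro a b ha hb e he; simp [ha e he, hb e he]
  zero_mem' := by intro e _; rfl
  smul_mem' := by intro r a ha e he; simp [ha e he]

/-- cycle space -/
def Zs {V : Type} [Fintype V] (H : SimpleGraph V) : Submodule (ZMod 2) (Sym2 V → ZMod 2) :=
  chains H ⊓ LinearMap.ker (bd V)

/-- restriction of `H` to a set of vertices, other vertices become isolated -/
def res {V : Type} (H : SimpleGraph V) (s : Set V) : SimpleGraph V where
  Adj a b := H.Adj a b ∧ a ∈ s ∧ b ∈ s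
  symm := ⟨fun _ _ h => ⟨h.1.symm, h.2.2, h.2.1⟩⟩
  loopless := ⟨fun _ h => h.1.ne rfl⟩

/-- cyclomatic number -/
noncomputable def bt {V : Type} [Fintype V] (H : SimpleGraph V) : ℕ :=
  Module.finrank (ZMod 2) (Zs H)

/-- delete the edges at `X` -/
def del {V : Type} (H : SimpleGraph V) (X : Finset V) : SimpleGraph V := res H {v | v ∉ X}

def ConnOn {V : Type} (H : SimpleGraph V) (s : Finset V) : Prop :=
  s.Nonempty ∧ (∀ u v, H.Adj u v → u ∈ s ∧ v ∈ s) ∧ ∀ u ∈ s, ∀ v ∈ s, H.Reachable u v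

theorem mem_chains {V : Type} {H : SimpleGraph V} {c : Sym2 V → ZMod 2} :
    c ∈ chains H ↔ ∀ e, e ∉ H.edgeSet → c e = 0 := Iff.rfl

theorem mem_Zs {V : Type} [Fintype V] {H : SimpleGraph V} {c : Sym2 V → ZMod 2} :
    c ∈ Zs H ↔ (∀ e, e ∉ H.edgeSet → c e = 0) ∧ ∀ v, ∑ u, c s(v, u) = 0 := by
  unfold Zs
  rw [Submodule.mem_inf, mem_chains, LinearMap.mem_ker]
  constructor
  · rintro ⟨h1, h2⟩
    exact ⟨h1, fun v => congrFun h2 v⟩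
  · rintro ⟨h1, h2⟩
    exact ⟨h1, funext h2⟩

theorem bd_single {V : Type} [Fintype V] [DecidableEq V] {a b : V} (hab : a ≠ b) :
    bd V (Pi.single s(a, b) 1) = Pi.single a 1 + Pi.single b 1 := by
  ext v
  show ∑ u, (Pi.single s(a, b) (1 : ZMod 2) : Sym2 V → ZMod 2) s(v, u) = _
  simp only [Pi.single_apply, Pi.add_apply, Sym2.eq_iff]
  by_cases h1 : v = a
  · subst h1
    rw [Finset.sum_eq_single b]
    · simp [hab]
    · intro u _ hu; simp [hu, hab]
    · simp
  · by_cases h2 : v = b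
    · subst h2
      rw [Finset.sum_eq_single a]
      · simp [h1]
      · intro u _ hu; simp [hu, h1]
      · simp
    · simp [h1, h2]

theorem chains_mono {V : Type} {H K : SimpleGraph V} (h : H ≤ K) : chains H ≤ chains K := by
  intro c hc e he
  exact hc e (fun h' => he (SimpleGraph.edgeSet_mono h h'))

theorem Zs_mono {V : Type} [Fintype V] {H K : SimpleGraph V} (h : H ≤ K) : Zs H ≤ Zs K :=
  inf_le_inf_right _ (chains_mono h)

/-- the chain of a walk -/
noncomputable def wc {V : Type} [DecidableEq V] {H : SimpleGraph V} {u v : V} (p : H.Walk u v) :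
    Sym2 V → ZMod 2 := (p.edges.map (fun e => (Pi.single e 1 : Sym2 V → ZMod 2))).sum

theorem wc_apply {V : Type} [DecidableEq V] {H : SimpleGraph V} {u v : V} (p : H.Walk u v)
    (e : Sym2 V) : wc p e = (p.edges.count e : ZMod 2) := by
  unfold wc
  generalize p.edges = l
  induction l with
  | nil => simp
  | cons a l ih =>
    rw [List.map_cons, List.sum_cons, Pi.add_apply, ih, List.count_cons]
    by_cases h : a = e
    · subst h; simp [add_comm]
    · simp [h, Ne.symm h]

theorem wc_mem {V : Type} [DecidableEq V] {H : SimpleGraph V} {u v : V} (p : H.Walk u v) :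
    wc p ∈ chains H := by
  intro e he
  rw [wc_apply, List.count_eq_zero_of_not_mem]
  · simp
  · intro h; exact he (p.edges_subset_edgeSet h)

theorem bd_wc {V : Type} [Fintype V] [DecidableEq V] {H : SimpleGraph V} {u v : V}
    (p : H.Walk u v) : bd V (wc p) = Pi.single u 1 + Pi.single v 1 := by
  induction p with
  | nil =>
    unfold wc
    simp only [SimpleGraph.Walk.edges_nil, List.map_nil, List.sum_nil, map_zero]
    ext x
    simp only [Pi.zero_apply, Pi.add_apply]
    exact (CharTwo.add_self_eq_zero _).symm
  | @cons a b c h p ih =>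
    have : wc (SimpleGraph.Walk.cons h p) = Pi.single s(a, b) 1 + wc p := by
      unfold wc; simp
    rw [this, map_add, ih, bd_single h.ne]
    ext x
    simp only [Pi.add_apply]
    have := CharTwo.add_self_eq_zero ((Pi.single b 1 : V → ZMod 2) x)
    linear_combination this

theorem finrank_chains {V : Type} [Fintype V] (H : SimpleGraph V) :
    Module.finrank (ZMod 2) (chains H) = H.edgeSet.ncard := by
  classical
  let f : chains H ≃ₗ[ZMod 2] (H.edgeSet → ZMod 2) :=
    { toFun := fun c e => c.1 e.1
      map_add' := fun a b => rfl
      map_smul' := fun a b => rfl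
      invFun := fun c => ⟨fun e => if h : e ∈ H.edgeSet then c ⟨e, h⟩ else 0, by
        intro e he; simp [he]⟩
      left_inv := by
        intro c
        ext e
        by_cases h : e ∈ H.edgeSet
        · simp [h]
        · simp [h, c.2 e h]
      right_inv := by
        intro c
        ext e
        simp }
  rw [f.finrank_eq, Module.finrank_fintype_fun_eq_card, Set.ncard_eq_toFinset_card',
    Set.toFinset_card]

theorem bt_eq {V : Type} [Fintype V] [DecidableEq V] {H : SimpleGraph V} {s : Finset V}
    (hs : ConnOn H s) : bt H + s.card = H.edgeSet.ncard + 1 := by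
  obtain ⟨⟨u0, hu0⟩, hin, hreach⟩ := hs
  let f := (bd V).domRestrict (chains H)
  have hrn := LinearMap.finrank_range_add_finrank_ker f
  rw [finrank_chains] at hrn
  have hker : Module.finrank (ZMod 2) (LinearMap.ker f) = bt H := by
    unfold bt
    have h1 : Zs H = (LinearMap.ker f).map (chains H).subtype := by
      ext c
      simp only [Zs, Submodule.mem_inf, Submodule.mem_map, LinearMap.mem_ker, Submodule.subtype_apply]
      constructor
      · rintro ⟨h1, h2⟩
        exact ⟨⟨c, h1⟩, h2, rfl⟩
      · rintro ⟨y, h2, rfl⟩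
        exact ⟨y.2, h2⟩
    rw [h1]
    exact LinearEquiv.finrank_eq (Submodule.equivMapOfInjective _ (Submodule.injective_subtype _) _)
  have hspan : LinearMap.range f ⊔ Submodule.span (ZMod 2) {(Pi.single u0 1 : V → ZMod 2)} =
      Submodule.span (ZMod 2) (Set.range (fun v : s => (Pi.single v.1 1 : V → ZMod 2))) := by
    apply le_antisymm
    · apply sup_le
      · rintro _ ⟨⟨c, hc⟩, rfl⟩
        have hx : ∀ v, v ∉ s → (bd V c) v = 0 := by
          intro v hv
          show ∑ u, c s(v, u) = 0
          apply Finset.sum_eq_zero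
          intro u _
          apply hc
          intro h
          exact hv (hin _ _ h).1
        show bd V c ∈ _
        rw [← Finset.univ_sum_single (bd V c)]
        apply Submodule.sum_mem
        intro v _
        by_cases hv : v ∈ s
        · have : (Pi.single v (bd V c v) : V → ZMod 2) = (bd V c v) • (Pi.single v 1 : V → ZMod 2) := by
            rw [← Pi.single_smul]; simp
          rw [this]
          apply Submodule.smul_mem
          exact Submodule.subset_span ⟨⟨v, hv⟩, rfl⟩
        · rw [hx v hv, Pi.single_zero]
          exact Submodule.zero_mem _
      · rw [Submodule.span_le, Set.singleton_subset_iff]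
        exact Submodule.subset_span ⟨⟨u0, hu0⟩, rfl⟩
    · rw [Submodule.span_le]
      rintro _ ⟨⟨v, hv⟩, rfl⟩
      obtain ⟨p⟩ := hreach u0 hu0 v hv
      have h1 : bd V (wc p) ∈ LinearMap.range f := ⟨⟨wc p, wc_mem p⟩, rfl⟩
      rw [bd_wc] at h1
      have h2 : (Pi.single v 1 : V → ZMod 2) =
          (Pi.single u0 1 + Pi.single v 1) + Pi.single u0 1 := by
        ext x
        simp only [Pi.add_apply]
        have := CharTwo.add_self_eq_zero ((Pi.single u0 1 : V → ZMod 2) x)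
        linear_combination -this
      show (Pi.single v 1 : V → ZMod 2) ∈ _
      rw [h2]
      exact Submodule.add_mem_sup h1 (Submodule.mem_span_singleton_self _)
  have hfr : Module.finrank (ZMod 2)
      (Submodule.span (ZMod 2) (Set.range (fun v : s => (Pi.single v.1 1 : V → ZMod 2)))) = s.card := by
    rw [finrank_span_eq_card]
    · simp
    · have := (Pi.basisFun (ZMod 2) V).linearIndependent
      have h2 := this.comp (fun v : s => v.1) Subtype.val_injective
      convert h2 using 1
      ext v
      simp
  have hnot : (Pi.single u0 1 : V → ZMod 2) ∉ LinearMap.range f := by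
    rintro ⟨⟨c, hc⟩, h⟩
    have h' : bd V c = Pi.single u0 1 := h
    have h1 : ∑ v, bd V c v = 1 := by rw [h']; simp
    have h2 : ∑ v, bd V c v = 0 := by
      show ∑ v, ∑ u, c s(v, u) = 0
      rw [← Finset.sum_product']
      apply Finset.sum_involution (fun p _ => (p.2, p.1))
      · rintro ⟨a, b⟩ _
        show c s(a, b) + c s(b, a) = 0
        rw [Sym2.eq_swap]
        exact CharTwo.add_self_eq_zero _
      · rintro ⟨a, b⟩ _ hne heq
        apply hne
        have : a = b := by
          have := congrArg Prod.snd heq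
          simpa using this
        subst this
        apply hc
        simp
      · simp
      · simp
    rw [h1] at h2
    exact one_ne_zero h2
  have := finrank_sup_span_of_notMem _ _ hnot
  rw [hspan, hfr] at this
  omega

/-! ### The dual picture -/

/-- evaluation of cycles at an edge -/
def ev {V : Type} [Fintype V] (H : SimpleGraph V) (e : Sym2 V) : Module.Dual (ZMod 2) (Zs H) where
  toFun z := z.1 e
  map_add' _ _ := rfl
  map_smul' _ _ := rfl

/-- span of the evaluations at edges containing `v` -/
def Lv {V : Type} [Fintype V] (H : SimpleGraph V) (v : V) :
    Submodule (ZMod 2) (Module.Dual (ZMod 2) (Zs H)) :=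
  Submodule.span (ZMod 2) (Set.range fun u => ev H s(v, u))

def Sub3 {V : Type} (H : SimpleGraph V) : Prop := ∀ v, (H.neighborSet v).ncard ≤ 3

theorem Sub3.mono {V : Type} [Finite V] {H K : SimpleGraph V} (h : H ≤ K) (hK : Sub3 K) : Sub3 H :=
  fun v => (Set.ncard_le_ncard (fun _ hw => h hw) (Set.toFinite _)).trans (hK v)

theorem mem_dc_sup {V : Type} [Fintype V] (H : SimpleGraph V) (X : Finset V) (z : Zs H) :
    z ∈ (X.sup (Lv H)).dualCoannihilator ↔ ∀ v ∈ X, ∀ u, z.1 s(v, u) = 0 := by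
  rw [Submodule.mem_dualCoannihilator]
  constructor
  · intro h v hv u
    exact h (ev H s(v, u)) ((Finset.le_sup (f := Lv H) hv) (Submodule.subset_span ⟨u, rfl⟩))
  · intro h f hf
    have : X.sup (Lv H) ≤ LinearMap.ker (Module.Dual.eval (ZMod 2) (Zs H) z) := by
      apply Finset.sup_le
      intro v hv
      apply Submodule.span_le.2
      rintro _ ⟨u, rfl⟩
      exact h v hv u
    exact this hf

theorem mem_Zs_del {V : Type} [Fintype V] (H : SimpleGraph V) (X : Finset V) (z : Sym2 V → ZMod 2) :
    z ∈ Zs (del H X) ↔ z ∈ Zs H ∧ ∀ v ∈ X, ∀ u, z s(v, u) = 0 := by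
  rw [mem_Zs, mem_Zs]
  constructor
  · rintro ⟨h1, h2⟩
    refine ⟨⟨fun e he => h1 e ?_, h2⟩, fun v hv u => h1 _ ?_⟩
    · induction e with | _ a b =>
      intro h
      exact he h.1
    · intro h
      exact h.2.1 hv
  · rintro ⟨⟨h1, h2⟩, h3⟩
    refine ⟨fun e he => ?_, h2⟩
    induction e with | _ a b =>
    by_cases ha : a ∈ X
    · exact h3 a ha b
    by_cases hb : b ∈ X
    · rw [Sym2.eq_swap]; exact h3 b hb a
    apply h1
    intro h
    exact he ⟨h, ha, hb⟩

theorem finrank_sup_Lv {V : Type} [Fintype V] (H : SimpleGraph V) (X : Finset V) :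
    Module.finrank (ZMod 2) ↥(X.sup (Lv H)) + bt (del H X) = bt H := by
  have h := Subspace.finrank_add_finrank_dualCoannihilator_eq (X.sup (Lv H))
  have h2 : bt (del H X) = Module.finrank (ZMod 2) ↥(X.sup (Lv H)).dualCoannihilator := by
    unfold bt
    have h1 : Zs (del H X) = (X.sup (Lv H)).dualCoannihilator.map (Zs H).subtype := by
      ext c
      rw [mem_Zs_del, Submodule.mem_map]
      constructor
      · rintro ⟨h1, h2⟩
        exact ⟨⟨c, h1⟩, (mem_dc_sup H X _).2 h2, rfl⟩
      · rintro ⟨y, h2, rfl⟩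
        exact ⟨y.2, (mem_dc_sup H X _).1 h2⟩
    rw [h1]
    exact (LinearEquiv.finrank_eq (Submodule.equivMapOfInjective _
      (Submodule.injective_subtype _) _)).symm
  rw [h2, h]
  rfl

theorem finrank_Lv_le {V : Type} [Fintype V] [DecidableEq V] {H : SimpleGraph V} (hH : Sub3 H)
    (v : V) : Module.finrank (ZMod 2) (Lv H v) ≤ 2 := by
  classical
  have hev : ∀ u, ¬ H.Adj v u → ev H s(v, u) = 0 := by
    intro u hu
    ext z
    exact (mem_Zs.1 z.2).1 _ hu
  have hsum : ∑ u, ev H s(v, u) = 0 := by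
    ext z
    rw [LinearMap.sum_apply]
    exact (mem_Zs.1 z.2).2 v
  by_cases hne : ∃ u0, H.Adj v u0
  · obtain ⟨u0, hu0⟩ := hne
    let N : Finset V := (Finset.univ.filter (fun u => H.Adj v u)).erase u0
    have hN : N.card ≤ 2 := by
      have h1 : (Finset.univ.filter (fun u => H.Adj v u)).card ≤ 3 := by
        have := hH v
        rw [Set.ncard_eq_toFinset_card'] at this
        convert this using 2
        ext; simp
      have : N.card = _ := Finset.card_erase_of_mem (by simp [hu0])
      omega
    have hle : Lv H v ≤ Submodule.span (ZMod 2)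
        ((N.image fun u => ev H s(v, u) : Finset _) : Set (Module.Dual (ZMod 2) (Zs H))) := by
      apply Submodule.span_le.2
      have key : ∀ u, u ≠ u0 → ev H s(v, u) ∈ Submodule.span (ZMod 2)
        ((N.image fun u => ev H s(v, u) : Finset _) : Set (Module.Dual (ZMod 2) (Zs H))) := by
        intro u hu
        by_cases hvu : H.Adj v u
        · apply Submodule.subset_span
          simp only [Finset.coe_image, Set.mem_image, Finset.mem_coe]
          exact ⟨u, by simp [N, hu, hvu], rfl⟩
        · rw [hev u hvu]; exact Submodule.zero_mem _
      rintro _ ⟨u, rfl⟩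
      by_cases hu : u = u0
      · subst hu
        rw [← Finset.add_sum_erase _ _ (Finset.mem_univ u)] at hsum
        show ev H s(v, u) ∈ _
        rw [eq_neg_of_add_eq_zero_left hsum]
        apply Submodule.neg_mem
        apply Submodule.sum_mem
        intro w hw
        exact key w (Finset.ne_of_mem_erase hw)
      · exact key u hu
    refine (Submodule.finrank_mono hle).trans ((finrank_span_finset_le_card _).trans ?_)
    exact Finset.card_image_le.trans hN
  · have : Lv H v = ⊥ := by
      rw [Lv, Submodule.span_eq_bot]
      rintro _ ⟨u, rfl⟩
      exact hev u (fun h => hne ⟨u, h⟩)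
    rw [this]; simp

theorem bt_le_del {V : Type} [Fintype V] [DecidableEq V] {H : SimpleGraph V} (hH : Sub3 H)
    (X : Finset V) : bt H ≤ bt (del H X) + 2 * X.card := by
  have h1 := finrank_sup_L_le (Lv H) (finrank_Lv_le hH) X
  have h2 := finrank_sup_Lv H X
  omega

theorem span_of_coann {V : Type} [Fintype V] (H : SimpleGraph V)
    (W : Submodule (ZMod 2) (Module.Dual (ZMod 2) (Zs H)))
    (h : ∀ z : Zs H, (∀ f ∈ W, f z = 0) → z = 0) : W = ⊤ := by
  have h1 := Subspace.finrank_add_finrank_dualCoannihilator_eq W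
  have h2 : W.dualCoannihilator = ⊥ := by
    rw [eq_bot_iff]
    intro z hz
    rw [Submodule.mem_dualCoannihilator] at hz
    exact (Submodule.mem_bot _).2 (h z hz)
  rw [h2, finrank_bot, add_zero] at h1
  apply Submodule.eq_top_of_finrank_eq
  rw [h1, Subspace.dual_finrank_eq]

theorem span_ev {V : Type} [Fintype V] (H : SimpleGraph V) :
    Submodule.span (ZMod 2) (Set.range (fun e : H.edgeSet => ev H e.1)) = ⊤ := by
  apply span_of_coann
  intro z hz
  apply Subtype.ext
  funext e
  by_cases he : e ∈ H.edgeSet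
  · exact hz _ (Submodule.subset_span ⟨⟨e, he⟩, rfl⟩)
  · exact (mem_Zs.1 z.2).1 e he

/-- `X` is independent in `H` -/
def Good {V : Type} [Fintype V] (H : SimpleGraph V) (X : Finset V) : Prop :=
  bt H = bt (del H X) + 2 * X.card

theorem good_iff {V : Type} [Fintype V] (H : SimpleGraph V) (X : Finset V) :
    Good H X ↔ Module.finrank (ZMod 2) ↥(X.sup (Lv H)) = 2 * X.card := by
  have h2 := finrank_sup_Lv H X
  unfold Good
  omega

/-! ### Graph versions -/

theorem mem_Zs_deleteEdge {V : Type} [Fintype V] (K : SimpleGraph V) (e : Sym2 V)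
    (z : Sym2 V → ZMod 2) : z ∈ Zs (K.deleteEdges {e}) ↔ z ∈ Zs K ∧ z e = 0 := by
  rw [mem_Zs, mem_Zs]
  simp only [SimpleGraph.edgeSet_deleteEdges, Set.mem_sdiff, Set.mem_singleton_iff]
  constructor
  · rintro ⟨h1, h2⟩
    exact ⟨⟨fun f hf => h1 f (fun h => hf h.1), h2⟩, h1 e (fun h => h.2 rfl)⟩
  · rintro ⟨⟨h1, h2⟩, h3⟩
    refine ⟨fun f hf => ?_, h2⟩
    by_cases hfe : f = e
    · rw [hfe]; exact h3
    · exact h1 f (fun h => hf ⟨h, hfe⟩)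

theorem bt_deleteEdge {V : Type} [Fintype V] (K : SimpleGraph V) (e : Sym2 V) :
    bt K ≤ bt (K.deleteEdges {e}) + 1 := by
  have h := LinearMap.finrank_range_add_finrank_ker (ev K e)
  have h1 : Module.finrank (ZMod 2) (LinearMap.range (ev K e)) ≤ 1 := by
    have := Submodule.finrank_le (LinearMap.range (ev K e))
    simpa using this
  have h2 : bt (K.deleteEdges {e}) = Module.finrank (ZMod 2) (LinearMap.ker (ev K e)) := by
    unfold bt
    have h1 : Zs (K.deleteEdges {e}) = (LinearMap.ker (ev K e)).map (Zs K).subtype := by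
      ext c
      rw [mem_Zs_deleteEdge, Submodule.mem_map]
      constructor
      · rintro ⟨h1, h2⟩
        exact ⟨⟨c, h1⟩, h2, rfl⟩
      · rintro ⟨y, h2, rfl⟩
        exact ⟨y.2, h2⟩
    rw [h1]
    exact (LinearEquiv.finrank_eq (Submodule.equivMapOfInjective _
      (Submodule.injective_subtype _) _)).symm
  unfold bt at *
  omega

theorem bt_mono {V : Type} [Fintype V] {H K : SimpleGraph V} (h : H ≤ K) : bt H ≤ bt K :=
  Submodule.finrank_mono (Zs_mono h)

theorem del_deleteEdges {V : Type} (H : SimpleGraph V) (e : Sym2 V) (X : Finset V) :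
    del (H.deleteEdges {e}) X = (del H X).deleteEdges {e} := by
  ext a b
  simp only [del, res, SimpleGraph.deleteEdges_adj]
  tauto

theorem edge_chain {V : Type} {H : SimpleGraph V} {a b : V} (p : H.Walk a b) :
    ∀ e f : H.edgeSet, a ∈ e.1 → b ∈ f.1 →
    Relation.ReflTransGen (fun e f : H.edgeSet => ∃ w, w ∈ e.1 ∧ w ∈ f.1) e f := by
  induction p with
  | nil => intro e f he hf; exact Relation.ReflTransGen.single ⟨_, he, hf⟩
  | @cons a c b h p ih =>
    intro e f he hf
    have h1 := ih ⟨s(a, c), h⟩ f (by simp) hf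
    exact Relation.ReflTransGen.head ⟨a, he, by simp⟩ h1

theorem gallai_graph {V : Type} [Fintype V] [DecidableEq V] {H : SimpleGraph V} {s : Finset V}
    (hH : Sub3 H) (hs : ConnOn H s) (ν : ℕ) (hmax : ∀ X, Good H X → X.card ≤ ν)
    (hmiss : ∀ e ∈ H.edgeSet, ∃ Y : Finset V, Y.card = ν ∧ Good H Y ∧
      ∃ z ∈ Zs (del H Y), z e ≠ 0) : bt H ≤ 2 * ν + 1 := by
  have h := gallai (fun e : H.edgeSet => ev H e.1) (Lv H) (fun v => {e | v ∈ e.1})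
    (by
      rintro v ⟨e, he⟩ hv
      obtain ⟨u, rfl⟩ := hv
      exact Submodule.subset_span ⟨u, rfl⟩)
    (finrank_Lv_le hH) (span_ev H) ν
    (fun X hX => hmax X ((good_iff H X).2 hX))
    (by
      rintro ⟨e, he⟩
      obtain ⟨Y, hY, hg, z, hz, hze⟩ := hmiss e he
      refine ⟨Y, hY, ?_, ?_⟩
      · rw [← hY]; exact (good_iff H Y).1 hg
      · intro hmem
        rw [mem_Zs_del] at hz
        have := (mem_dc_sup H Y ⟨z, hz.1⟩).2 hz.2
        rw [Submodule.mem_dualCoannihilator] at this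
        exact hze (this _ hmem))
    (by
      rintro ⟨e, he⟩ ⟨f, hf⟩
      induction e with | _ a b =>
      induction f with | _ c d =>
      obtain ⟨p⟩ := hs.2.2 a (hs.2.1 _ _ he).1 c (hs.2.1 _ _ hf).1
      exact edge_chain p _ _ (by simp) (by simp))
  rw [Subspace.dual_finrank_eq] at h
  exact h

theorem critical_edge {V : Type} [Fintype V] [DecidableEq V] {H : SimpleGraph V} {s : Finset V}
    (hH : Sub3 H) (hs : ConnOn H s) {e : Sym2 V} (he : e ∈ H.edgeSet)
    (hs' : ConnOn (H.deleteEdges {e}) s) {Y : Finset V} (hY : Good (H.deleteEdges {e}) Y) :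
    Good H Y ∧ ∃ z ∈ Zs (del H Y), z e ≠ 0 := by
  have h1 := bt_eq hs
  have h2 := bt_eq hs'
  have h3 : (H.deleteEdges {e}).edgeSet.ncard + 1 = H.edgeSet.ncard := by
    rw [SimpleGraph.edgeSet_deleteEdges]
    exact Set.ncard_sdiff_singleton_add_one he (Set.toFinite _)
  have h4 := bt_le_del hH Y
  have h5 := bt_deleteEdge (del H Y) e
  rw [← del_deleteEdges] at h5
  unfold Good at *
  refine ⟨by omega, ?_⟩
  by_contra hcon
  push Not at hcon
  have : Zs (del H Y) ≤ Zs (del (H.deleteEdges {e}) Y) := by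
    intro z hz
    rw [del_deleteEdges, mem_Zs_deleteEdge]
    exact ⟨hz, hcon z hz⟩
  have := Submodule.finrank_mono this
  unfold bt at *
  omega

theorem good_nbr {V : Type} [Fintype V] [DecidableEq V] {H : SimpleGraph V} (hH : Sub3 H)
    {X : Finset V} (hX : Good H X) {x : V} (hx : x ∈ X) : ∃ y, H.Adj x y := by
  by_contra hno
  push Not at hno
  have h1 : del H (X.erase x) = del H X := by
    ext a b
    simp only [del, res, Finset.mem_erase, Set.mem_ofPred_eq]
    constructor
    · rintro ⟨h, ha, hb⟩
      refine ⟨h, fun h' => ha ⟨?_, h'⟩, fun h' => hb ⟨?_, h'⟩⟩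
      · rintro rfl; exact hno _ h
      · rintro rfl; exact hno _ h.symm
    · rintro ⟨h, ha, hb⟩
      exact ⟨h, fun h' => ha h'.2, fun h' => hb h'.2⟩
  have h2 := bt_le_del hH (X.erase x)
  rw [h1] at h2
  have h3 := Finset.card_erase_of_mem hx
  have h4 : 0 < X.card := Finset.card_pos.2 ⟨x, hx⟩
  unfold Good at hX
  omega

theorem good_union {V : Type} [Fintype V] [DecidableEq V] {H H1 H2 : SimpleGraph V} (hH : Sub3 H)
    (h1 : H1 ≤ H) (h2 : H2 ≤ H) (hd : ∀ e ∈ H1.edgeSet, e ∉ H2.edgeSet)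
    (hb : bt H = bt H1 + bt H2) {X1 X2 : Finset V} (hX1 : Good H1 X1) (hX2 : Good H2 X2)
    (hX : Disjoint X1 X2) : Good H (X1 ∪ X2) := by
  have hinf : Zs H1 ⊓ Zs H2 = ⊥ := by
    rw [eq_bot_iff]
    rintro z ⟨hz1, hz2⟩
    rw [Submodule.mem_bot]
    funext e
    by_cases he : e ∈ H1.edgeSet
    · exact (mem_Zs.1 hz2).1 e (hd e he)
    · exact (mem_Zs.1 hz1).1 e he
  have hsup : Zs H1 ⊔ Zs H2 = Zs H := by
    apply Submodule.eq_of_le_of_finrank_eq (sup_le (Zs_mono h1) (Zs_mono h2))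
    have := Submodule.finrank_sup_add_finrank_inf_eq (Zs H1) (Zs H2)
    rw [hinf, finrank_bot] at this
    unfold bt at hb
    omega
  have hle : Zs (del H (X1 ∪ X2)) ≤ Zs (del H1 X1) ⊔ Zs (del H2 X2) := by
    intro z hz
    rw [mem_Zs_del] at hz
    obtain ⟨hz, hz0⟩ := hz
    rw [← hsup] at hz
    obtain ⟨z1, hz1, z2, hz2, rfl⟩ := Submodule.mem_sup.1 hz
    refine Submodule.add_mem_sup ?_ ?_
    · rw [mem_Zs_del]
      refine ⟨hz1, fun v hv u => ?_⟩
      by_cases he : s(v, u) ∈ H1.edgeSet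
      · have h3 := (mem_Zs.1 hz2).1 _ (hd _ he)
        have h4 := hz0 v (Finset.mem_union_left _ hv) u
        rw [Pi.add_apply, h3, add_zero] at h4
        exact h4
      · exact (mem_Zs.1 hz1).1 _ he
    · rw [mem_Zs_del]
      refine ⟨hz2, fun v hv u => ?_⟩
      by_cases he : s(v, u) ∈ H2.edgeSet
      · have h3 := (mem_Zs.1 hz1).1 _ (fun h => hd _ h he)
        have h4 := hz0 v (Finset.mem_union_right _ hv) u
        rw [Pi.add_apply, h3, zero_add] at h4
        exact h4
      · exact (mem_Zs.1 hz2).1 _ he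
  have h5 := Submodule.finrank_mono hle
  have h6 := Submodule.finrank_add_le_finrank_add_finrank (Zs (del H1 X1)) (Zs (del H2 X2))
  have h7 := bt_le_del hH (X1 ∪ X2)
  have h8 := Finset.card_union_of_disjoint hX
  unfold Good bt at *
  omega

theorem connOn_comp {V : Type} {H K : SimpleGraph V} {s t : Finset V} {u : V}
    (hK : K ≤ H) (hin : ∀ u v, H.Adj u v → u ∈ s ∧ v ∈ s) (hu : u ∈ s)
    (ht : ∀ w, w ∈ t ↔ w ∈ s ∧ K.Reachable u w) : ConnOn (res H t) t := by
  have hut : u ∈ t := (ht u).2 ⟨hu, SimpleGraph.Reachable.refl _⟩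
  have key : ∀ w, K.Reachable u w → (res H t).Reachable u w := by
    intro w hw
    rw [SimpleGraph.reachable_iff_reflTransGen] at hw
    induction hw with
    | refl => exact SimpleGraph.Reachable.refl _
    | @tail b c hb hbc ih =>
      refine ih.trans (SimpleGraph.Adj.reachable ?_)
      have hb' := (SimpleGraph.reachable_iff_reflTransGen _ _).2 hb
      exact ⟨hK hbc, (ht b).2 ⟨(hin _ _ (hK hbc)).1, hb'⟩,
        (ht c).2 ⟨(hin _ _ (hK hbc)).2, hb'.trans hbc.reachable⟩⟩
  refine ⟨⟨u, hut⟩, fun a b h => h.2, fun a ha b hb => ?_⟩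
  exact (key a ((ht a).1 ha).2).symm.trans (key b ((ht b).1 hb).2)

theorem bridge_split {V : Type} [Fintype V] [DecidableEq V] {H : SimpleGraph V} {s : Finset V}
    (hs : ConnOn H s) {e : Sym2 V} (he : e ∈ H.edgeSet) (hn : ¬ ConnOn (H.deleteEdges {e}) s) :
    ∃ s1 s2 : Finset V, Disjoint s1 s2 ∧ s1 ∪ s2 = s ∧ ConnOn (res H s1) s1 ∧ ConnOn (res H s2) s2 ∧
      (res H s1).edgeSet.ncard + (res H s2).edgeSet.ncard + 1 = H.edgeSet.ncard := by
  classical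
  induction e with | _ u v =>
  set K := H.deleteEdges {s(u, v)} with hKdef
  have hKH : K ≤ H := SimpleGraph.deleteEdges_le _
  have huv : H.Adj u v := he
  obtain ⟨hu, hv⟩ := hs.2.1 u v huv
  have hreach : ∀ w, H.Reachable u w → K.Reachable u w ∨ K.Reachable v w := by
    intro w hw
    rw [SimpleGraph.reachable_iff_reflTransGen] at hw
    induction hw with
    | refl => exact Or.inl (SimpleGraph.Reachable.refl _)
    | @tail b c hb hbc ih =>
      by_cases hbe : s(b, c) = s(u, v)
      · rw [Sym2.eq_iff] at hbe
        rcases hbe with ⟨_, rfl⟩ | ⟨_, rfl⟩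
        · exact Or.inr (SimpleGraph.Reachable.refl _)
        · exact Or.inl (SimpleGraph.Reachable.refl _)
      · have : K.Adj b c := by
          rw [hKdef, SimpleGraph.deleteEdges_adj]; exact ⟨hbc, hbe⟩
        exact ih.imp (fun h => h.trans this.reachable) (fun h => h.trans this.reachable)
  have hnv : ¬ K.Reachable u v := by
    intro h
    apply hn
    refine ⟨hs.1, fun a b hab => hs.2.1 a b (hKH hab), fun a ha b hb => ?_⟩
    have : ∀ w ∈ s, K.Reachable u w := fun w hw =>
      (hreach w (hs.2.2 u hu w hw)).elim id (fun h' => h.trans h')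
    exact (this a ha).symm.trans (this b hb)
  let s1 := s.filter (fun w => K.Reachable u w)
  let s2 := s.filter (fun w => K.Reachable v w)
  have hdis : Disjoint s1 s2 := by
    rw [Finset.disjoint_left]
    intro w h1 h2
    exact hnv ((Finset.mem_filter.1 h1).2.trans (Finset.mem_filter.1 h2).2.symm)
  have hun : s1 ∪ s2 = s := by
    ext w
    simp only [s1, s2, Finset.mem_union, Finset.mem_filter]
    constructor
    · rintro (h | h) <;> exact h.1
    · intro h
      rcases hreach w (hs.2.2 u hu w h) with h' | h'
      · exact Or.inl ⟨h, h'⟩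
      · exact Or.inr ⟨h, h'⟩
  refine ⟨s1, s2, hdis, hun, connOn_comp hKH hs.2.1 hu (fun w => Finset.mem_filter),
    connOn_comp hKH hs.2.1 hv (fun w => Finset.mem_filter), ?_⟩
  have hunion : H.edgeSet = ((res H s1).edgeSet ∪ (res H s2).edgeSet) ∪ {s(u, v)} := by
    ext f
    induction f with | _ a b =>
    simp only [Set.mem_union, Set.mem_singleton_iff, SimpleGraph.mem_edgeSet]
    constructor
    · intro hab
      by_cases hf : s(a, b) = s(u, v)
      · exact Or.inr hf
      · left
        have hK : K.Adj a b := by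
          rw [hKdef, SimpleGraph.deleteEdges_adj]; exact ⟨hab, hf⟩
        obtain ⟨ha, hb⟩ := hs.2.1 a b hab
        rcases hreach a (hs.2.2 u hu a ha) with h' | h'
        · exact Or.inl ⟨hab, Finset.mem_filter.2 ⟨ha, h'⟩, Finset.mem_filter.2 ⟨hb, h'.trans hK.reachable⟩⟩
        · exact Or.inr ⟨hab, Finset.mem_filter.2 ⟨ha, h'⟩, Finset.mem_filter.2 ⟨hb, h'.trans hK.reachable⟩⟩
    · rintro ((h | h) | h)
      · exact h.1
      · exact h.1
      · rw [← SimpleGraph.mem_edgeSet, h]; exact he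
  have hd1 : Disjoint (res H s1).edgeSet (res H s2).edgeSet := by
    rw [Set.disjoint_left]
    intro f
    induction f with | _ a b =>
    intro h1 h2
    exact (Finset.disjoint_left.1 hdis) h1.2.1 h2.2.1
  have hd2 : Disjoint ((res H s1).edgeSet ∪ (res H s2).edgeSet) {s(u, v)} := by
    rw [Set.disjoint_singleton_right]
    rintro (h | h)
    · have h1 : u ∈ s1 ∧ v ∈ s1 := h.2
      exact hnv (Finset.mem_filter.1 h1.2).2
    · have h1 : u ∈ s2 ∧ v ∈ s2 := h.2
      exact hnv (Finset.mem_filter.1 h1.1).2.symm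
  rw [hunion, Set.ncard_union_eq hd2 (Set.toFinite _) (Set.toFinite _),
    Set.ncard_union_eq hd1 (Set.toFinite _) (Set.toFinite _), Set.ncard_singleton]

theorem extend_sup {V : Type} [Fintype V] [DecidableEq V] (H : SimpleGraph V) (n : ℕ) :
    ∀ S : Finset V, bt H ≤ Module.finrank (ZMod 2) ↥(S.sup (Lv H)) + n →
      ∃ S' : Finset V, S'.card ≤ S.card + n ∧ S'.sup (Lv H) = ⊤ := by
  induction n with
  | zero =>
    intro S hS
    refine ⟨S, by simp, ?_⟩
    apply Submodule.eq_top_of_finrank_eq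
    apply le_antisymm (Submodule.finrank_le _)
    rw [Subspace.dual_finrank_eq]
    exact hS
  | succ n ih =>
    intro S hS
    by_cases htop : S.sup (Lv H) = ⊤
    · exact ⟨S, by omega, htop⟩
    · have : ∃ v u, ev H s(v, u) ∉ S.sup (Lv H) := by
        by_contra hcon
        push Not at hcon
        apply htop
        rw [eq_top_iff, ← span_ev H, Submodule.span_le]
        rintro _ ⟨⟨e, he⟩, rfl⟩
        induction e with | _ a b =>
        exact hcon a b
      obtain ⟨v, u, hvu⟩ := this
      have h1 : S.sup (Lv H) ⊔ Submodule.span (ZMod 2) {ev H s(v, u)} ≤ (insert v S).sup (Lv H) := by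
        rw [Finset.sup_insert, sup_comm]
        apply sup_le_sup_right
        rw [Submodule.span_le, Set.singleton_subset_iff]
        exact Submodule.subset_span ⟨u, rfl⟩
      have h2 := Submodule.finrank_mono h1
      rw [finrank_sup_span_of_notMem _ _ hvu] at h2
      obtain ⟨S', h3, h4⟩ := ih (insert v S) (by omega)
      refine ⟨S', ?_, h4⟩
      have := Finset.card_insert_le v S
      omega

theorem phi_le {V : Type} [Fintype V] [DecidableEq V] {G : SimpleGraph V} {X : Finset V}
    (hX : Good G X) : phi G + X.card ≤ bt G := by
  have hg := (good_iff G X).1 hX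
  have hX' := hX
  unfold Good at hX'
  obtain ⟨S, hS, htop⟩ := extend_sup G (bt G - 2 * X.card) X (by omega)
  have hb := finrank_sup_Lv G S
  have hbt : Module.finrank (ZMod 2) (⊤ : Submodule (ZMod 2) (Module.Dual (ZMod 2) (Zs G))) = bt G := by
    rw [finrank_top, Subspace.dual_finrank_eq]; rfl
  rw [htop, hbt] at hb
  have hz : Zs (del G S) = ⊥ := by
    apply Submodule.finrank_eq_zero.1
    unfold bt at hb
    omega
  have hac : (G.induce ((S : Set V)ᶜ)).IsAcyclic := by
    intro v c hc
    let f : (G.induce ((S : Set V)ᶜ)) →g del G S :=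
      { toFun := fun x => x.1
        map_rel' := by
          intro a b hab
          exact ⟨hab, a.2, b.2⟩ }
    have hc' : (c.map f).IsCycle := hc.map (fun a b h => Subtype.ext h)
    have hmem : wc (c.map f) ∈ Zs (del G S) := by
      refine ⟨wc_mem _, ?_⟩
      rw [SetLike.mem_coe, LinearMap.mem_ker, bd_wc]
      ext x
      simp only [Pi.add_apply]
      exact CharTwo.add_self_eq_zero _
    rw [hz, Submodule.mem_bot] at hmem
    have hlen : (c.map f).edges ≠ [] := by
      intro h
      have := hc'.three_le_length
      rw [← SimpleGraph.Walk.length_edges, h] at this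
      simp at this
    obtain ⟨e, he⟩ := List.exists_mem_of_ne_nil _ hlen
    have h1 := congrFun hmem e
    rw [wc_apply, List.count_eq_one_of_mem hc'.edges_nodup he] at h1
    simp at h1
  have : phi G ≤ S.card := Nat.sInf_le ⟨S, rfl, hac⟩
  omega

/-! ### The main induction -/

def IsC4 {V : Type} (H : SimpleGraph V) (a b c d : V) : Prop :=
  H.Adj a b ∧ H.Adj b c ∧ H.Adj c d ∧ H.Adj d a ∧ a ≠ c ∧ b ≠ d

def C4 {V : Type} (H : SimpleGraph V) : Prop := ∃ a b c d, IsC4 H a b c d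

theorem C4.mono {V : Type} {H K : SimpleGraph V} (h : H ≤ K) (hH : C4 H) : C4 K := by
  obtain ⟨a, b, c, d, h1, h2, h3, h4, h5⟩ := hH
  exact ⟨a, b, c, d, h h1, h h2, h h3, h h4, h5⟩

open Classical in
noncomputable def sg {V : Type} [Fintype V] (H : SimpleGraph V) (s : Finset V) : ℕ :=
  if s = Finset.univ ∨ C4 H then 1 else 0

theorem sg_mono {V : Type} [Fintype V] {H K : SimpleGraph V} (h : H ≤ K) (s : Finset V) :
    sg H s ≤ sg K s := by
  unfold sg
  by_cases h1 : s = Finset.univ ∨ C4 H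
  · rw [if_pos h1, if_pos (h1.imp id (C4.mono h))]
  · rw [if_neg h1]; exact Nat.zero_le _

theorem res_mono {V : Type} {H K : SimpleGraph V} (h : H ≤ K) (s : Set V) : res H s ≤ res K s :=
  fun _ _ hab => ⟨h hab.1, hab.2⟩

theorem res_le {V : Type} (H : SimpleGraph V) (s : Set V) : res H s ≤ H :=
  fun _ _ hab => hab.1

theorem sg_split {V : Type} [Fintype V] [DecidableEq V] {G H : SimpleGraph V} (hHG : H ≤ G)
    (hND : ∀ s1 s2 : Finset V, Disjoint s1 s2 → C4 (res G s1) → C4 (res G s2) → False)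
    {s s1 s2 : Finset V} (hd : Disjoint s1 s2) (h1 : s1.Nonempty) (h2 : s2.Nonempty) :
    sg (res H s1) s1 + sg (res H s2) s2 ≤ sg H s := by
  have hu1 : s1 ≠ Finset.univ := by
    rintro rfl
    obtain ⟨x, hx⟩ := h2
    exact Finset.disjoint_left.1 hd (Finset.mem_univ x) hx
  have hu2 : s2 ≠ Finset.univ := by
    rintro rfl
    obtain ⟨x, hx⟩ := h1
    exact Finset.disjoint_left.1 hd hx (Finset.mem_univ x)
  unfold sg
  by_cases c1 : C4 (res H (s1 : Set V))
  · by_cases c2 : C4 (res H (s2 : Set V))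
    · exact (hND s1 s2 hd (c1.mono (res_mono hHG _)) (c2.mono (res_mono hHG _))).elim
    · rw [if_pos (Or.inr c1), if_neg (not_or.2 ⟨hu2, c2⟩), if_pos (Or.inr (c1.mono (res_le _ _)))]
  · by_cases c2 : C4 (res H (s2 : Set V))
    · rw [if_neg (not_or.2 ⟨hu1, c1⟩), if_pos (Or.inr c2), if_pos (Or.inr (c2.mono (res_le _ _)))]
    · rw [if_neg (not_or.2 ⟨hu1, c1⟩), if_neg (not_or.2 ⟨hu2, c2⟩)]; exact Nat.zero_le _

theorem good_empty {V : Type} [Fintype V] (H : SimpleGraph V) : Good H ∅ := by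
  have : del H ∅ = H := by
    ext a b
    simp [del, res]
  unfold Good
  rw [this]; simp

theorem exists_max_good {V : Type} [Fintype V] (H : SimpleGraph V) :
    ∃ X, Good H X ∧ ∀ Y, Good H Y → Y.card ≤ X.card := by
  classical
  obtain ⟨X, hX, hmax⟩ := Finset.exists_max_image (Finset.univ.filter (fun X => Good H X))
    Finset.card ⟨∅, by simp [good_empty]⟩
  exact ⟨X, (Finset.mem_filter.1 hX).2, fun Y hY => hmax Y (by simp [hY])⟩

theorem main_ind {V : Type} [Fintype V] [DecidableEq V] {G : SimpleGraph V} (hG : Sub3 G)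
    (hND : ∀ s1 s2 : Finset V, Disjoint s1 s2 → C4 (res G s1) → C4 (res G s2) → False)
    (hcrit : ∀ (H : SimpleGraph V) (s : Finset V) (ν : ℕ), H ≤ G → ConnOn H s →
      (∀ e ∈ H.edgeSet, ConnOn (H.deleteEdges {e}) s) → H.edgeSet.ncard ≤ s.card + 2 * ν →
      5 * H.edgeSet.ncard + 5 ≤ 6 * s.card + 7 * ν + 2 * sg H s) (k : ℕ) :
    ∀ (H : SimpleGraph V) (s : Finset V), H.edgeSet.ncard = k → H ≤ G → ConnOn H s →
      ∃ X, Good H X ∧ 5 * H.edgeSet.ncard + 5 ≤ 6 * s.card + 7 * X.card + 2 * sg H s := by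
  induction k using Nat.strong_induction_on with
  | _ k ih =>
  intro H s hk hHG hs
  have hH : Sub3 H := hG.mono hHG
  by_cases hbr : ∀ e ∈ H.edgeSet, ConnOn (H.deleteEdges {e}) s
  · obtain ⟨X, hX, hmax⟩ := exists_max_good H
    refine ⟨X, hX, ?_⟩
    by_cases hred : ∃ e ∈ H.edgeSet, ∀ Y, Good (H.deleteEdges {e}) Y → Y.card < X.card
    · obtain ⟨e, he, hY⟩ := hred
      have h3 : (H.deleteEdges {e}).edgeSet.ncard + 1 = H.edgeSet.ncard := by
        rw [SimpleGraph.edgeSet_deleteEdges]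
        exact Set.ncard_sdiff_singleton_add_one he (Set.toFinite _)
      have hle : H.deleteEdges {e} ≤ H := SimpleGraph.deleteEdges_le _
      obtain ⟨Y, hgY, hYb⟩ := ih _ (by omega) (H.deleteEdges {e}) s rfl (hle.trans hHG) (hbr e he)
      have := hY Y hgY
      have := sg_mono hle s
      omega
    · push Not at hred
      apply hcrit H s X.card hHG hs hbr
      have := gallai_graph hH hs X.card hmax (by
        intro e he
        obtain ⟨Y, hY, hYc⟩ := hred e he
        have h1 := critical_edge hH hs he (hbr e he) hY
        exact ⟨Y, le_antisymm (hmax Y h1.1) hYc, h1⟩)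
      have h2 := bt_eq hs
      omega
  · push Not at hbr
    obtain ⟨e, he, hn⟩ := hbr
    obtain ⟨s1, s2, hd, hun, hc1, hc2, hm⟩ := bridge_split hs he hn
    obtain ⟨X1, hX1, hb1⟩ := ih _ (by omega) (res H s1) s1 rfl ((res_le _ _).trans hHG) hc1
    obtain ⟨X2, hX2, hb2⟩ := ih _ (by omega) (res H s2) s2 rfl ((res_le _ _).trans hHG) hc2
    have hdX : Disjoint X1 X2 := by
      rw [Finset.disjoint_left]
      intro x h1 h2
      obtain ⟨y, hy⟩ := good_nbr (hH.mono (res_le _ _)) hX1 h1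
      obtain ⟨z, hz⟩ := good_nbr (hH.mono (res_le _ _)) hX2 h2
      exact Finset.disjoint_left.1 hd hy.2.1 hz.2.1
    have hcard : s1.card + s2.card = s.card := by
      rw [← hun, Finset.card_union_of_disjoint hd]
    have e1 := bt_eq hc1
    have e2 := bt_eq hc2
    have e3 := bt_eq hs
    refine ⟨X1 ∪ X2, good_union hH (res_le _ _) (res_le _ _) ?_ (by omega) hX1 hX2 hdX, ?_⟩
    · intro f
      induction f with | _ a b =>
      intro h1 h2
      exact Finset.disjoint_left.1 hd h1.2.1 h2.2.1
    · rw [Finset.card_union_of_disjoint hdX]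
      have := sg_split hHG hND (s := s) hd hc1.1 hc2.1
      omega

/-! ### A small search engine -/

/-- adjacency in a bit matrix -/
def adjB (M a b : ℕ) : Bool := Nat.beq 1 (Nat.land (Nat.shiftRight M (Nat.add (Nat.mul 16 a) b)) 1)

def addE (M i j : ℕ) : ℕ := Nat.lor (Nat.lor M (Nat.shiftLeft 1 (Nat.add (Nat.mul 16 i) j))) (Nat.shiftLeft 1 (Nat.add (Nat.mul 16 j) i))

def addAll (M i : ℕ) : List ℕ → ℕ
  | [] => M
  | j :: l => addAll (addE M i j) i l

def nbrs (M k a : ℕ) : List ℕ := (List.range k).filter (fun b => adjB M a b)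

/-- sublists of bounded length -/
def subs : ℕ → List ℕ → List (List ℕ)
  | 0, _ => [[]]
  | _ + 1, [] => [[]]
  | m + 1, x :: l => subs (m + 1) l ++ (subs m l).map (fun t => x :: t)

def rowB (M a : ℕ) : ℕ := Nat.land (Nat.shiftRight M (Nat.mul 16 a)) 65535

def disjB (x y : ℕ) : Bool := Nat.beq (Nat.land x y) 0

def orRows (M : ℕ) : List ℕ → ℕ
  | [] => 0
  | x :: l => Nat.lor (rowB M x) (orRows M l)

def condB (g : Bool) (M k i R B j : ℕ) : Bool :=
  !adjB M i j && (disjB R (rowB M j) && ((!g || disjB B (rowB M j)) &&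
    Nat.blt (nbrs M k j).length 3))

def candB (g : Bool) (M k i R B : ℕ) : List ℕ :=
  (List.range' (Nat.add i 1) (Nat.sub k (Nat.add i 1))).filter fun j => condB g M k i R B j

def pairB (g : Bool) (M : ℕ) (T : List ℕ) : Bool :=
  T.all fun x => T.all fun y => Nat.beq x y ||
    (!adjB M x y && (!g || disjB (rowB M x) (rowB M y)))

def searchB (n : ℕ) (g : Bool) (fin : ℕ → Bool) : ℕ → ℕ → ℕ → ℕ → ℕ → Bool
  | 0, _, _, _, _ => false
  | f + 1, q, i, k, M =>
    bif Nat.ble k i then !(Nat.beq k n) || fin M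
    else [2, 3].all fun D =>
      Nat.blt q (Nat.sub 3 D) || (Nat.blt D (nbrs M k i).length ||
        (subs (Nat.sub D (nbrs M k i).length)
            (candB g M k i (rowB M i) (orRows M (nbrs M k i)))).all fun T =>
          Nat.blt n (Nat.add k (Nat.sub (Nat.sub D (nbrs M k i).length) T.length)) ||
          (!pairB g M T ||
            searchB n g fin f (Nat.sub q (Nat.sub 3 D)) (Nat.add i 1)
              (Nat.add k (Nat.sub (Nat.sub D (nbrs M k i).length) T.length))
              (addAll M i (T ++ List.range' k (Nat.sub (Nat.sub D (nbrs M k i).length) T.length)))))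

/-! reverse operations -/

def degTwoB (M : ℕ) (vs : List ℕ) (z : ℕ) : Bool :=
  Nat.beq (vs.filter (fun b => adjB M z b)).length 2

def inFB : List Bool → ℕ → ℕ → List ℕ → ℕ → Bool
  | [], i, j, vs, M =>
    ((Nat.beq vs.length 3 && Nat.beq i 3 && Nat.beq j 0) ||
      (Nat.beq vs.length 4 && Nat.beq i 1 && Nat.beq j 1)) &&
    vs.all fun a => vs.all fun b => Nat.beq a b || adjB M a b
  | false :: mv, i, j, vs, M =>
    !(Nat.beq i 0) && vs.any fun x =>
      match vs.filter (fun b => adjB M x b) with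
      | [a, b] => !adjB M a b && inFB mv (i - 1) j (vs.filter fun v => !(Nat.beq v x)) (addE M a b)
      | _ => false
  | true :: mv, i, j, vs, M =>
    !(Nat.beq j 0) && vs.any fun w =>
      match vs.filter (fun b => adjB M w b) with
      | [p, q, r] =>
        [(p, q, r), (p, r, q), (q, r, p)].any fun t =>
          !adjB M t.1 t.2.1 &&
          match (vs.filter fun v => !(Nat.beq v w)).filter (fun b => adjB M t.1 b),
              (vs.filter fun v => !(Nat.beq v w)).filter (fun b => adjB M t.2.1 b) with
          | [a, b], [c, d] =>
            !adjB M a b && !adjB M c d &&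
            !(Nat.beq a c && Nat.beq b d) && !(Nat.beq a d && Nat.beq b c) &&
            let vs' := (vs.filter fun v => !(Nat.beq v w)).filter fun v =>
                !(Nat.beq v t.1) && !(Nat.beq v t.2.1)
            let M' := addE (addE M a b) c d
            degTwoB M' vs' t.2.2 && inFB mv i (j - 1) vs' M'
          | _, _ => false
      | _ => false

def twoC4B (M : ℕ) : Bool :=
  (List.range 8).any fun a => (nbrs M 8 a).any fun b => (nbrs M 8 b).any fun c =>
    !(Nat.beq a c) && (nbrs M 8 c).any fun d => adjB M d a && !(Nat.beq b d) &&
    (List.range 8).any fun a' => !([a, b, c, d].contains a') &&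
    (nbrs M 8 a').any fun b' => !([a, b, c, d].contains b') &&
    (nbrs M 8 b').any fun c' => !([a, b, c, d].contains c') &&
    !(Nat.beq a' c') && (nbrs M 8 c').any fun d' => !([a, b, c, d].contains d') &&
    adjB M d' a' && !(Nat.beq b' d')

theorem adjB_eq (M a b : ℕ) : adjB M a b = M.testBit (16 * a + b) := by
  unfold adjB
  show Nat.beq 1 ((M >>> (16 * a + b)) &&& 1) = _
  rw [Nat.and_one_is_mod, Nat.testBit_eq_decide_div_mod_eq, Nat.shiftRight_eq_div_pow,
    Bool.eq_iff_iff, Nat.beq_eq, decide_eq_true_iff]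
  exact eq_comm

theorem adjB_addE {M i j a b : ℕ} (hi : i < 16) (hj : j < 16) (ha : a < 16) (hb : b < 16) :
    adjB (addE M i j) a b = true ↔ adjB M a b = true ∨ (a = i ∧ b = j) ∨ (a = j ∧ b = i) := by
  rw [adjB_eq, adjB_eq]
  show ((M ||| (1 <<< (16 * i + j))) ||| (1 <<< (16 * j + i))).testBit (16 * a + b) = true ↔ _
  rw [Nat.testBit_or, Nat.testBit_or, Nat.one_shiftLeft, Nat.one_shiftLeft, Nat.testBit_two_pow,
    Nat.testBit_two_pow, Bool.or_eq_true, Bool.or_eq_true, decide_eq_true_iff, decide_eq_true_iff,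
    or_assoc]
  refine or_congr Iff.rfl (or_congr ?_ ?_) <;> omega

theorem adjB_addAll {i : ℕ} (hi : i < 16) (l : List ℕ) : ∀ {M a b : ℕ}, (∀ j ∈ l, j < 16) →
    a < 16 → b < 16 → (adjB (addAll M i l) a b = true ↔
      adjB M a b = true ∨ (a = i ∧ b ∈ l) ∨ (b = i ∧ a ∈ l)) := by
  induction l with
  | nil => intro M a b _ _ _; simp [addAll]
  | cons j l ih =>
    intro M a b hl ha hb
    rw [addAll, ih (fun x hx => hl x (by simp [hx])) ha hb,
      adjB_addE hi (hl j (by simp)) ha hb]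
    simp only [List.mem_cons]
    tauto

theorem testBit_rowB (M a b : ℕ) : (rowB M a).testBit b = true ↔ b < 16 ∧ adjB M a b = true := by
  rw [adjB_eq]
  show ((M >>> (16 * a)) &&& (2 ^ 16 - 1)).testBit b = true ↔ _
  rw [Nat.testBit_and, Nat.testBit_shiftRight, Nat.testBit_two_pow_sub_one, Bool.and_eq_true,
    decide_eq_true_iff]
  tauto

theorem disjB_of {x y : ℕ} (h : ∀ b, x.testBit b = true → y.testBit b = true → False) :
    disjB x y = true := by
  unfold disjB
  rw [Nat.beq_eq]
  show x &&& y = 0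
  apply Nat.eq_of_testBit_eq
  intro b
  rw [Nat.testBit_and, Nat.zero_testBit, Bool.and_eq_false_iff]
  by_contra hcon
  push Not at hcon
  exact h b (by simpa using hcon.1) (by simpa using hcon.2)

theorem testBit_orRows (M : ℕ) (l : List ℕ) (b : ℕ) :
    (orRows M l).testBit b = true ↔ ∃ x ∈ l, (rowB M x).testBit b = true := by
  induction l with
  | nil => simp [orRows]
  | cons x l ih =>
    rw [orRows]
    show (rowB M x ||| orRows M l).testBit b = true ↔ _
    rw [Nat.testBit_or, Bool.or_eq_true, ih]
    simp

theorem mem_nbrs {M k a b : ℕ} : b ∈ nbrs M k a ↔ b < k ∧ adjB M a b = true := by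
  simp [nbrs]

theorem mem_subs (T : List ℕ) : ∀ (l : List ℕ) (m : ℕ), T.Sublist l → T.length ≤ m →
    T ∈ subs m l := by
  intro l
  induction l generalizing T with
  | nil =>
    intro m h _
    have := List.sublist_nil.1 h
    subst this
    cases m <;> simp [subs]
  | cons x l ih =>
    intro m h hm
    cases m with
    | zero =>
      have := List.length_eq_zero_iff.1 (Nat.le_zero.1 hm)
      subst this
      simp [subs]
    | succ m =>
      rw [subs, List.mem_append]
      cases h with
      | cons _ h => exact Or.inl (ih T _ h hm)
      | cons_cons _ h =>
        right
        rw [List.mem_map]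
        exact ⟨_, ih _ m h (by simpa using hm), rfl⟩

open Classical in
/-- neighbours -/
noncomputable def nb {V : Type} [Fintype V] (H : SimpleGraph V) (v : V) : Finset V :=
  Finset.univ.filter (fun w => H.Adj v w)

theorem mem_nb {V : Type} [Fintype V] {H : SimpleGraph V} {v w : V} : w ∈ nb H v ↔ H.Adj v w := by
  simp [nb]

/-- degree -/
noncomputable def dg {V : Type} [Fintype V] (H : SimpleGraph V) (v : V) : ℕ := (nb H v).card

/-- invariant of the search -/
structure SInv {V : Type} (H : SimpleGraph V) (s : Finset V) (i k M : ℕ) (L : ℕ → V) : Prop where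
  hik : i ≤ k
  k16 : k < 16
  inj : ∀ a < k, ∀ b < k, L a = L b → a = b
  mem : ∀ a < k, L a ∈ s
  snd : ∀ a < 16, ∀ b < 16, adjB M a b = true → a < k ∧ b < k ∧ adjB M b a = true ∧ H.Adj (L a) (L b)
  full : ∀ a < i, ∀ w, H.Adj (L a) w → ∃ b < k, w = L b ∧ adjB M a b = true

theorem SInv.step {V : Type} [Fintype V] [DecidableEq V] {H : SimpleGraph V} {s : Finset V}
    {i k M : ℕ} {L : ℕ → V} (hI : SInv H s i k M L) (hi : i < k) (hs : s.card < 16)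
    (hin : ∀ u v, H.Adj u v → u ∈ s ∧ v ∈ s) :
    ∃ (T : List ℕ) (r : ℕ) (L' : ℕ → V),
      (∀ p : ℕ → Bool, (∀ j, i < j → j < k → adjB M i j = false → H.Adj (L i) (L j) → p j = true) →
        T.Sublist ((List.range' (Nat.add i 1) (Nat.sub k (Nat.add i 1))).filter p)) ∧
      (∀ j ∈ T, i < j ∧ j < k ∧ adjB M i j = false ∧ H.Adj (L i) (L j)) ∧
      SInv H s (i + 1) (k + r) (addAll M i (T ++ List.range' k r)) L' ∧ (∀ a < k, L' a = L a) ∧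
      dg H (L i) = (nbrs M k i).length + T.length + r ∧ k + r ≤ s.card := by
  classical
  have hk := hI.k16
  let R := nb H (L i) \ (Finset.range k).image L
  let T := (List.range' (Nat.add i 1) (Nat.sub k (Nat.add i 1))).filter
    (fun j => decide (adjB M i j = false ∧ H.Adj (L i) (L j)))
  let e : R ≃ Fin R.card := R.equivFin
  let L' : ℕ → V := fun j => if h : j - k < R.card ∧ k ≤ j then (e.symm ⟨j - k, h.1⟩).1 else L j
  have hL' : ∀ a < k, L' a = L a := by
    intro a ha
    simp only [L']
    rw [dif_neg (by omega)]
  have hL2 : ∀ a, k ≤ a → a < k + R.card → L' a ∈ R := by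
    intro a h1 h2
    simp only [L']
    rw [dif_pos ⟨by omega, h1⟩]
    exact (e.symm _).2
  have hL3 : ∀ w ∈ R, ∃ a, k ≤ a ∧ a < k + R.card ∧ L' a = w := by
    intro w hw
    have h1 := (e ⟨w, hw⟩).2
    refine ⟨k + (e ⟨w, hw⟩).1, by omega, by omega, ?_⟩
    simp only [L']
    rw [dif_pos ⟨by omega, by omega⟩]
    have : (⟨k + (e ⟨w, hw⟩).1 - k, by omega⟩ : Fin R.card) = e ⟨w, hw⟩ := by
      apply Fin.ext; simp
    rw [this, Equiv.symm_apply_apply]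
  have hRn : ∀ w ∈ R, H.Adj (L i) w ∧ ∀ a < k, w ≠ L a := by
    intro w hw
    simp only [R, Finset.mem_sdiff, mem_nb, Finset.mem_image, Finset.mem_range, not_exists, not_and] at hw
    exact ⟨hw.1, fun a ha h => hw.2 a ha h.symm⟩
  have hT : ∀ j, j ∈ T ↔ i < j ∧ j < k ∧ adjB M i j = false ∧ H.Adj (L i) (L j) := by
    intro j
    simp only [T, List.mem_filter, List.mem_range', decide_eq_true_iff, one_mul]
    constructor
    · rintro ⟨⟨x, hx, rfl⟩, h⟩
      have h1 : Nat.add i 1 = i + 1 := rfl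
      have h2 : Nat.sub k (Nat.add i 1) = k - (i + 1) := rfl
      rw [h2] at hx
      rw [h1] at *
      exact ⟨by omega, by omega, h⟩
    · rintro ⟨h1, h2, h⟩
      refine ⟨⟨j - (i + 1), ?_, ?_⟩, h⟩
      · show _ < k - (i + 1); omega
      · show j = (i + 1) + _; omega
  have hjT : ∀ j < k, adjB M i j = false → H.Adj (L i) (L j) → j ∈ T := by
    intro j hj hA hadj
    rw [hT]
    refine ⟨?_, hj, hA, hadj⟩
    by_contra hle
    rcases Nat.lt_or_ge j i with h | h
    · obtain ⟨b, hb, hb1, hb2⟩ := hI.full j h _ hadj.symm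
      have := hI.inj i hi b hb hb1
      subst this
      have := (hI.snd j (by omega) i (by omega) hb2).2.2.1
      rw [hA] at this
      exact absurd this (by simp)
    · have : j = i := by omega
      subst this
      exact hadj.ne rfl
  have hcardk : ((Finset.range k).image L).card = k := by
    rw [Finset.card_image_of_injOn, Finset.card_range]
    intro a ha b hb hab
    exact hI.inj a (by simpa using ha) b (by simpa using hb) hab
  have hdisj : Disjoint ((Finset.range k).image L) R := Finset.disjoint_sdiff
  have hkr : k + R.card ≤ s.card := by
    have : ((Finset.range k).image L) ∪ R ⊆ s := by
      intro w hw
      rcases Finset.mem_union.1 hw with h | h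
      · obtain ⟨a, ha, rfl⟩ := Finset.mem_image.1 h
        exact hI.mem a (by simpa using ha)
      · exact (hin _ _ (hRn w h).1).2
    have := Finset.card_le_card this
    rw [Finset.card_union_of_disjoint hdisj, hcardk] at this
    exact this
  have hl16 : ∀ j ∈ T ++ List.range' k R.card, j < 16 := by
    intro j hj
    rcases List.mem_append.1 hj with h | h
    · have := ((hT j).1 h).2.1; omega
    · have := List.mem_range'_1.1 h; omega
  have hmemL : ∀ j ∈ T ++ List.range' k R.card, j < k + R.card ∧ H.Adj (L' i) (L' j) := by
    intro j hj
    rw [hL' i hi]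
    rcases List.mem_append.1 hj with h | h
    · have := (hT j).1 h
      rw [hL' j this.2.1]
      exact ⟨by omega, this.2.2.2⟩
    · have := List.mem_range'_1.1 h
      exact ⟨by omega, (hRn _ (hL2 j (by omega) (by omega))).1⟩
  refine ⟨T, R.card, L', ?_, fun j hj => (hT j).1 hj, ?_, hL', ?_, hkr⟩
  · intro p hp
    have : T = ((List.range' (Nat.add i 1) (Nat.sub k (Nat.add i 1))).filter p).filter
        (fun j => decide (adjB M i j = false ∧ H.Adj (L i) (L j))) := by
      rw [List.filter_filter]
      apply List.filter_congr
      intro j hj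
      by_cases hc : adjB M i j = false ∧ H.Adj (L i) (L j)
      · have hjm : j ∈ T := by
          simp only [T, List.mem_filter]
          exact ⟨hj, by simpa using hc⟩
        have := (hT j).1 hjm
        simp [hc, hp j this.1 this.2.1 hc.1 hc.2]
      · simp [hc]
    rw [this]
    exact List.filter_sublist
  · refine ⟨by omega, by omega, ?_, ?_, ?_, ?_⟩
    · intro a ha b hb hab
      by_cases h1 : a < k
      · by_cases h2 : b < k
        · rw [hL' a h1, hL' b h2] at hab
          exact hI.inj a h1 b h2 hab
        · rw [hL' a h1] at hab
          exact absurd hab.symm ((hRn _ (hL2 b (by omega) hb)).2 a h1)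
      · by_cases h2 : b < k
        · rw [hL' b h2] at hab
          exact absurd hab ((hRn _ (hL2 a (by omega) ha)).2 b h2)
        · simp only [L'] at hab
          rw [dif_pos ⟨by omega, by omega⟩, dif_pos ⟨by omega, by omega⟩] at hab
          have := e.symm.injective (Subtype.ext hab)
          have := congrArg Fin.val this
          simp only at this
          omega
    · intro a ha
      by_cases h1 : a < k
      · rw [hL' a h1]; exact hI.mem a h1
      · exact (hin _ _ (hRn _ (hL2 a (by omega) ha)).1).2
    · intro a ha b hb hab
      rw [adjB_addAll (by omega) _ hl16 ha hb] at hab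
      rw [adjB_addAll (by omega) _ hl16 hb ha]
      rcases hab with h | ⟨rfl, h⟩ | ⟨rfl, h⟩
      · obtain ⟨h1, h2, h3, h4⟩ := hI.snd a ha b hb h
        rw [hL' a h1, hL' b h2]
        exact ⟨by omega, by omega, Or.inl h3, h4⟩
      · exact ⟨by omega, (hmemL b h).1, Or.inr (Or.inr ⟨rfl, h⟩), (hmemL b h).2⟩
      · exact ⟨(hmemL a h).1, by omega, Or.inr (Or.inl ⟨rfl, h⟩), (hmemL a h).2.symm⟩
    · intro a ha w hw
      rw [hL' a (by omega)] at hw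
      by_cases hai : a < i
      · obtain ⟨b, hb, rfl, h2⟩ := hI.full a hai w hw
        refine ⟨b, by omega, (hL' b hb).symm, ?_⟩
        rw [adjB_addAll (by omega) _ hl16 (by omega) (by omega)]
        exact Or.inl h2
      · have : a = i := by omega
        subst this
        by_cases hwi : ∃ b < k, w = L b
        · obtain ⟨b, hb, rfl⟩ := hwi
          refine ⟨b, by omega, (hL' b hb).symm, ?_⟩
          rw [adjB_addAll (by omega) _ hl16 (by omega) (by omega)]
          cases hA : adjB M a b with
          | true => exact Or.inl rfl
          | false => exact Or.inr (Or.inl ⟨rfl, List.mem_append.2 (Or.inl (hjT b hb hA hw))⟩)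
        · push Not at hwi
          have hwR : w ∈ R := by
            simp only [R, Finset.mem_sdiff, mem_nb, Finset.mem_image, Finset.mem_range,
              not_exists, not_and]
            exact ⟨hw, fun b hb h => hwi b hb h.symm⟩
          obtain ⟨b, h1, h2, rfl⟩ := hL3 w hwR
          refine ⟨b, h2, rfl, ?_⟩
          rw [adjB_addAll (by omega) _ hl16 (by omega) (by omega)]
          refine Or.inr (Or.inl ⟨rfl, List.mem_append.2 (Or.inr ?_)⟩)
          rw [List.mem_range'_1]; exact ⟨h1, h2⟩
  · have hTn : T.Nodup := List.Nodup.filter _ List.nodup_range'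
    have hNn : (nbrs M k i).Nodup := List.Nodup.filter _ List.nodup_range
    have happ : (nbrs M k i ++ T).Nodup := by
      apply List.Nodup.append hNn hTn
      intro j h1 h2
      have h3 := (mem_nbrs.1 h1).2
      rw [((hT j).1 h2).2.2.1] at h3
      exact absurd h3 (by simp)
    have heq : nb H (L i) = (nbrs M k i ++ T).toFinset.image L ∪ R := by
      ext w
      simp only [Finset.mem_union, Finset.mem_image, List.mem_toFinset, List.mem_append, mem_nb]
      constructor
      · intro hw
        by_cases hwi : ∃ b < k, w = L b
        · obtain ⟨b, hb, rfl⟩ := hwi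
          left
          refine ⟨b, ?_, rfl⟩
          cases hA : adjB M i b with
          | true => exact Or.inl (mem_nbrs.2 ⟨hb, hA⟩)
          | false => exact Or.inr (hjT b hb hA hw)
        · right
          push Not at hwi
          simp only [R, Finset.mem_sdiff, mem_nb, Finset.mem_image, Finset.mem_range,
              not_exists, not_and]
          exact ⟨hw, fun b hb h => hwi b hb h.symm⟩
      · rintro (⟨j, h | h, rfl⟩ | h)
        · have := mem_nbrs.1 h
          exact (hI.snd i (by omega) j (by omega) this.2).2.2.2
        · exact ((hT j).1 h).2.2.2
        · exact (hRn w h).1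
    have hlt : ∀ j ∈ nbrs M k i ++ T, j < k := by
      intro j hj
      rcases List.mem_append.1 hj with h | h
      · exact (mem_nbrs.1 h).1
      · exact ((hT j).1 h).2.1
    have hd2 : Disjoint ((nbrs M k i ++ T).toFinset.image L) R := by
      rw [Finset.disjoint_left]
      intro w h1 h2
      obtain ⟨j, hj, rfl⟩ := Finset.mem_image.1 h1
      exact (hRn _ h2).2 j (hlt j (List.mem_toFinset.1 hj)) rfl
    unfold dg
    rw [heq, Finset.card_union_of_disjoint hd2, Finset.card_image_of_injOn,
      List.toFinset_card_of_nodup happ, List.length_append]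
    intro a ha b hb hab
    exact hI.inj a (hlt a (by simpa using ha)) b (hlt b (by simpa using hb)) hab

theorem nbrs_lt {V : Type} [Fintype V] [DecidableEq V] {H : SimpleGraph V} {s : Finset V}
    {i k M : ℕ} {L : ℕ → V} (hI : SInv H s i k M L) {i' j : ℕ} (hi : i' < k) (hj : j < k)
    (hA : adjB M i' j = false) (hadj : H.Adj (L i') (L j)) :
    (nbrs M k j).length < dg H (L j) := by
  classical
  have hk := hI.k16
  have hNn : (nbrs M k j).Nodup := List.Nodup.filter _ List.nodup_range
  have hni : i' ∉ nbrs M k j := by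
    intro h
    have h1 := (hI.snd j (by omega) i' (by omega) (mem_nbrs.1 h).2).2.2.1
    rw [hA] at h1
    exact absurd h1 (by simp)
  have hsub : (i' :: nbrs M k j).toFinset.image L ⊆ nb H (L j) := by
    intro w hw
    obtain ⟨b, hb, rfl⟩ := Finset.mem_image.1 hw
    rw [mem_nb]
    rcases List.mem_cons.1 (List.mem_toFinset.1 hb) with rfl | h
    · exact hadj.symm
    · have := mem_nbrs.1 h
      exact (hI.snd j (by omega) b (by omega) this.2).2.2.2
  have := Finset.card_le_card hsub
  rw [Finset.card_image_of_injOn, List.toFinset_card_of_nodup (List.nodup_cons.2 ⟨hni, hNn⟩),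
    List.length_cons] at this
  · exact this
  · intro a ha b hb hab
    have hlt : ∀ c ∈ i' :: nbrs M k j, c < k := by
      intro c hc
      rcases List.mem_cons.1 hc with rfl | h
      · exact hi
      · exact (mem_nbrs.1 h).1
    exact hI.inj a (hlt a (by simpa using ha)) b (hlt b (by simpa using hb)) hab

theorem search_sound {V : Type} [Fintype V] [DecidableEq V] {H : SimpleGraph V} {s : Finset V}
    {n : ℕ} {g : Bool} {fin : ℕ → Bool} (hs : s.card = n) (hn : n < 16) (hc : ConnOn H s)
    (hd : ∀ v ∈ s, 2 ≤ dg H v ∧ dg H v ≤ 3)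
    (htri : ∀ a b c, H.Adj a b → H.Adj b c → H.Adj a c → False)
    (hg : g = true → ¬ C4 H) : ∀ (f q i k M : ℕ) (L : ℕ → V), SInv H s i k M L → 1 ≤ k →
      ∑ v ∈ s \ (Finset.range i).image L, (3 - dg H v) ≤ q → searchB n g fin f q i k M = true →
      ∃ M' L', SInv H s n n M' L' ∧ fin M' = true := by
  classical
  intro f
  induction f with
  | zero => intro q i k M L _ _ _ h; simp [searchB] at h
  | succ f ih =>
    intro q i k M L hI hk1 hq h
    rw [searchB] at h
    have hk := hI.k16
    rcases Nat.lt_or_ge i k with hik | hik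
    · have hb : Nat.ble k i = false := by
        cases hh : Nat.ble k i
        · rfl
        · have := Nat.le_of_ble_eq_true hh; omega
      rw [hb, cond_false] at h
      obtain ⟨T, r, L', hT1, hT2, hI', hL', hdg, hkr⟩ := hI.step hik (by omega) hc.2.1
      have hdi := hd _ (hI.mem i hik)
      have hpair : pairB g M T = true := by
        unfold pairB
        rw [List.all_eq_true]
        intro x hx
        rw [List.all_eq_true]
        intro y hy
        have h1 := hT2 x hx
        have h2 := hT2 y hy
        rw [Bool.or_eq_true, Nat.beq_eq]
        by_cases hxy : x = y
        · exact Or.inl hxy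
        right
        rw [Bool.and_eq_true]
        constructor
        · rw [Bool.not_eq_true', Bool.eq_false_iff]
          intro hh
          exact htri _ _ _ h1.2.2.2 (hI.snd x (by omega) y (by omega) hh).2.2.2 h2.2.2.2
        · cases hgg : g
          · rfl
          · rw [Bool.or_eq_true]
            right
            apply disjB_of
            intro b hb1 hb2
            rw [testBit_rowB] at hb1 hb2
            have h3 := hI.snd x (by omega) b (by omega) hb1.2
            have h4 := hI.snd y (by omega) b (by omega) hb2.2
            apply hg hgg
            refine ⟨L i, L x, L b, L y, h1.2.2.2, h3.2.2.2, h4.2.2.2.symm, h2.2.2.2.symm, ?_, ?_⟩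
            · intro hh
              have := hI.inj i hik b h3.2.1 hh
              subst this
              rw [h1.2.2.1] at h3
              exact absurd h3.2.2.1 (by simp)
            · intro hh
              exact hxy (hI.inj x (by omega) y (by omega) hh)
      have hsubl : T.Sublist (candB g M k i (rowB M i) (orRows M (nbrs M k i))) := by
        apply hT1
        intro j hij hjk hA hadj
        unfold condB
        rw [Bool.and_eq_true, Bool.and_eq_true, Bool.and_eq_true]
        refine ⟨by simp [hA], ?_, ?_, ?_⟩
        · apply disjB_of
          intro b hb1 hb2
          rw [testBit_rowB] at hb1 hb2
          have h3 := hI.snd i (by omega) b (by omega) hb1.2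
          have h4 := hI.snd j (by omega) b (by omega) hb2.2
          exact htri _ _ _ hadj h4.2.2.2 h3.2.2.2
        · cases hgg : g
          · rfl
          · rw [Bool.or_eq_true]
            right
            apply disjB_of
            intro b hb1 hb2
            rw [testBit_orRows] at hb1
            obtain ⟨x, hx, hb1⟩ := hb1
            rw [testBit_rowB] at hb1 hb2
            rw [mem_nbrs] at hx
            have h2 := hI.snd i (by omega) x (by omega) hx.2
            have h3 := hI.snd x (by omega) b (by omega) hb1.2
            have h4 := hI.snd j (by omega) b (by omega) hb2.2
            apply hg hgg
            refine ⟨L i, L x, L b, L j, h2.2.2.2, h3.2.2.2, h4.2.2.2.symm, hadj.symm, ?_, ?_⟩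
            · intro hh
              have := hI.inj i hik b h3.2.1 hh
              subst this
              rw [hA] at h4
              exact absurd h4.2.2.1 (by simp)
            · intro hh
              have := hI.inj x hx.1 j hjk hh
              subst this
              rw [hA] at hx
              exact absurd hx.2 (by simp)
        · have h1 := nbrs_lt hI hik hjk hA hadj
          have h2 := (hd _ (hI.mem j hjk)).2
          show Nat.ble _ _ = true
          exact Nat.ble_eq_true_of_le (by omega)
      have hsum : (3 - dg H (L i)) + ∑ v ∈ s \ (Finset.range (i + 1)).image L', (3 - dg H v) ≤ q := by
        refine le_trans (le_of_eq ?_) hq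
        have him : (Finset.range (i + 1)).image L' = insert (L i) ((Finset.range i).image L) := by
          rw [Finset.range_add_one, Finset.image_insert, hL' i hik]
          congr 1
          apply Finset.image_congr
          intro a ha
          have : a < i := by simpa using ha
          exact hL' a (by omega)
        have hni : L i ∈ s \ (Finset.range i).image L := by
          rw [Finset.mem_sdiff]
          refine ⟨hI.mem i hik, ?_⟩
          intro hh
          obtain ⟨a, ha, hh⟩ := Finset.mem_image.1 hh
          have ha : a < i := by simpa using ha
          have := hI.inj a (by omega) i hik hh
          omega
        rw [him, Finset.sdiff_insert, Finset.add_sum_erase _ (fun v => 3 - dg H v) hni]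
      rw [List.all_eq_true] at h
      have h := h (dg H (L i)) (by
        simp only [List.mem_cons, List.not_mem_nil, or_false]; omega)
      rw [Bool.or_eq_true, Bool.or_eq_true, List.all_eq_true] at h
      have hr : Nat.sub (Nat.sub (dg H (L i)) (nbrs M k i).length) T.length = r := by
        show (dg H (L i) - (nbrs M k i).length) - T.length = r
        omega
      rcases h with h | h | h
      · have : q < 3 - dg H (L i) := Nat.le_of_ble_eq_true h
        omega
      · have : dg H (L i) < (nbrs M k i).length := Nat.le_of_ble_eq_true h
        omega
      · have h := h T (mem_subs T _ _ hsubl (by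
          show T.length ≤ dg H (L i) - (nbrs M k i).length
          omega))
        rw [hr, Bool.or_eq_true, Bool.or_eq_true] at h
        rcases h with h | h | h
        · have : n < k + r := Nat.le_of_ble_eq_true h
          omega
        · rw [hpair] at h
          exact absurd h (by simp)
        · exact ih _ _ _ _ L' hI' (by show 1 ≤ k + r; omega) (by
            show _ ≤ q - (3 - dg H (L i))
            have : Nat.add i 1 = i + 1 := rfl
            omega) h
    · have hki : k = i := le_antisymm hik hI.hik
      subst hki
      have hb : Nat.ble k k = true := Nat.ble_eq_true_of_le le_rfl
      rw [hb, cond_true] at h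
      have hkn : k = n := by
        have hcardk : ((Finset.range k).image L).card = k := by
          rw [Finset.card_image_of_injOn, Finset.card_range]
          intro a ha b hb hab
          exact hI.inj a (by simpa using ha) b (by simpa using hb) hab
        have hwalk : ∀ u v, H.Walk u v → u ∈ (Finset.range k).image L → v ∈ (Finset.range k).image L := by
          intro u v w
          induction w with
          | nil => exact id
          | cons hadj _ ih2 =>
            intro hu
            apply ih2
            obtain ⟨a, ha, rfl⟩ := Finset.mem_image.1 hu
            obtain ⟨b, hb, rfl, _⟩ := hI.full a (by simpa using ha) _ hadj
            exact Finset.mem_image.2 ⟨b, by simpa using hb, rfl⟩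
        have h1 : s ⊆ (Finset.range k).image L := by
          intro v hv
          obtain ⟨w⟩ := hc.2.2 _ (hI.mem 0 (by omega)) v hv
          exact hwalk _ _ w (Finset.mem_image.2 ⟨0, Finset.mem_range.2 hk1, rfl⟩)
        have h2 : (Finset.range k).image L ⊆ s := by
          intro v hv
          obtain ⟨a, ha, rfl⟩ := Finset.mem_image.1 hv
          exact hI.mem a (by simpa using ha)
        rw [← hs, ← hcardk, Finset.Subset.antisymm h1 h2]
      subst hkn
      refine ⟨M, L, hI, ?_⟩
      rw [Bool.or_eq_true] at h
      rcases h with h | h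
      · simp at h
      · exact h

theorem search_start {V : Type} [Fintype V] [DecidableEq V] {H : SimpleGraph V} {s : Finset V}
    (hn : s.card < 16) (hc : ConnOn H s) {v : V} (hv : v ∈ s) :
    ∃ L, SInv H s 1 (1 + dg H v) (addAll 0 0 (List.range' 1 (dg H v))) L ∧ L 0 = v := by
  have h0 : SInv H s 0 1 0 (fun _ => v) := by
    refine ⟨by omega, by omega, by intro a ha b hb _; omega, fun _ _ => hv, ?_, by intro a ha; omega⟩
    intro a _ b _ h
    rw [adjB_eq] at h
    simp at h
  obtain ⟨T, r, L', hT1, hT2, hI', hL', hdg, hkr⟩ := h0.step (by omega) hn hc.2.1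
  have hT : T = [] := by
    rw [List.eq_nil_iff_forall_not_mem]
    intro j hj
    have := hT2 j hj
    omega
  subst hT
  have hN : nbrs 0 1 0 = [] := by decide
  rw [hN] at hdg
  simp only [List.length_nil] at hdg
  have : r = dg H v := by omega
  subst this
  exact ⟨L', hI', hL' 0 (by omega)⟩

theorem iso_sub {A V : Type} {K : SimpleGraph A} {H : SimpleGraph V} (f : V → A) (x : A) (u v : V)
    (hf : ∀ p q, f p = f q → p = q) (hx : ∀ p, f p ≠ x) (hs : ∀ a, a = x ∨ ∃ p, f p = a)
    (h1 : ∀ p, K.Adj x (f p) ↔ p = u ∨ p = v)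
    (h2 : ∀ p q, K.Adj (f p) (f q) ↔ H.Adj p q ∧ s(p, q) ≠ s(u, v)) :
    Nonempty (K ≃g subdivideEdge H u v) := by
  let F : Option V → A := fun o => o.elim x f
  have hb : Function.Bijective F := by
    constructor
    · rintro (_ | p) (_ | q) h
      · rfl
      · exact absurd h.symm (hx q)
      · exact absurd h (hx p)
      · rw [hf p q h]
    · intro a
      rcases hs a with rfl | ⟨p, rfl⟩
      · exact ⟨none, rfl⟩
      · exact ⟨some p, rfl⟩
  refine ⟨RelIso.symm ⟨Equiv.ofBijective F hb, ?_⟩⟩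
  rintro (_ | p) (_ | q)
  · show K.Adj x x ↔ _
    simp [subdivideEdge]
  · show K.Adj x (f q) ↔ _
    rw [h1]
    simp [subdivideEdge]
  · show K.Adj (f p) x ↔ _
    rw [K.adj_comm, h1]
    simp [subdivideEdge]
  · show K.Adj (f p) (f q) ↔ _
    rw [h2]
    simp only [subdivideEdge, fromRel_adj]
    constructor
    · intro h
      exact ⟨fun hh => h.1.ne (Option.some.inj hh), Or.inl (Or.inl ⟨p, q, rfl, rfl, h⟩)⟩
    · rintro ⟨_, (⟨p', q', hp, hq, h⟩ | ⟨h, _⟩) | (⟨p', q', hp, hq, h⟩ | ⟨h, _⟩)⟩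
      · cases hp; cases hq; exact h
      · cases h
      · cases hp; cases hq
        rw [Sym2.eq_swap, H.adj_comm]; exact h
      · cases h

theorem iso_op {A V : Type} {K : SimpleGraph A} {H : SimpleGraph V} (f : V → A) (x y w : A)
    (u v u' v' a : V)
    (hf : ∀ p q, f p = f q → p = q) (hx : ∀ p, f p ≠ x) (hy : ∀ p, f p ≠ y) (hw : ∀ p, f p ≠ w)
    (hxy : x ≠ y) (hxw : x ≠ w) (hyw : y ≠ w)
    (hs : ∀ a, a = x ∨ a = y ∨ a = w ∨ ∃ p, f p = a)
    (h1 : ∀ p, K.Adj x (f p) ↔ p = u ∨ p = v)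
    (h1' : ∀ p, K.Adj y (f p) ↔ p = u' ∨ p = v')
    (h3 : ∀ p, K.Adj w (f p) ↔ p = a)
    (h4 : K.Adj w x) (h5 : K.Adj w y) (h6 : ¬ K.Adj x y)
    (h2 : ∀ p q, K.Adj (f p) (f q) ↔ H.Adj p q ∧ s(p, q) ≠ s(u, v) ∧ s(p, q) ≠ s(u', v')) :
    Nonempty (K ≃g circOpTwo H u v u' v' a) := by
  let F : V ⊕ Fin 3 → A := Sum.elim f ![x, y, w]
  have hb : Function.Bijective F := by
    constructor
    · rintro (p | p) (q | q) h
      · rw [hf p q h]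
      · fin_cases q
        · exact absurd h (hx p)
        · exact absurd h (hy p)
        · exact absurd h (hw p)
      · fin_cases p
        · exact absurd h.symm (hx q)
        · exact absurd h.symm (hy q)
        · exact absurd h.symm (hw q)
      · fin_cases p <;> fin_cases q <;>
          first | rfl | exact absurd h hxy | exact absurd h hxw | exact absurd h hyw |
            exact absurd h.symm hxy | exact absurd h.symm hxw | exact absurd h.symm hyw
    · intro a
      rcases hs a with rfl | rfl | rfl | ⟨p, rfl⟩
      · exact ⟨Sum.inr 0, rfl⟩
      · exact ⟨Sum.inr 1, rfl⟩
      · exact ⟨Sum.inr 2, rfl⟩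
      · exact ⟨Sum.inl p, rfl⟩
  have key1 : ∀ (p : V) (q : Fin 3), K.Adj (![x, y, w] q) (f p) ↔
      (circOpTwo H u v u' v' a).Adj (Sum.inr q) (Sum.inl p) := by
    intro p q
    fin_cases q
    · show K.Adj x (f p) ↔ _
      rw [h1]; simp [circOpTwo]
    · show K.Adj y (f p) ↔ _
      rw [h1']; simp [circOpTwo]
    · show K.Adj w (f p) ↔ _
      rw [h3]; simp [circOpTwo]
  refine ⟨RelIso.symm ⟨Equiv.ofBijective F hb, ?_⟩⟩
  rintro (p | p) (q | q)
  · show K.Adj (f p) (f q) ↔ _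
    rw [h2]
    simp only [circOpTwo, fromRel_adj]
    constructor
    · intro h
      exact ⟨fun hh => h.1.ne (Sum.inl.inj hh), Or.inl (Or.inl ⟨p, q, rfl, rfl, h⟩)⟩
    · rintro ⟨_, (⟨p', q', hp, hq, h⟩ | ⟨h, _⟩ | ⟨h, _⟩ | ⟨h, _⟩) |
        (⟨p', q', hp, hq, h⟩ | ⟨h, _⟩ | ⟨h, _⟩ | ⟨h, _⟩)⟩
      · cases hp; cases hq; exact h
      · cases h
      · cases h
      · cases h
      · cases hp; cases hq
        rw [Sym2.eq_swap, H.adj_comm]; exact h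
      · cases h
      · cases h
      · cases h
  · show K.Adj (f p) (![x, y, w] q) ↔ _
    rw [K.adj_comm, key1, SimpleGraph.adj_comm]
  · exact key1 q p
  · show K.Adj (![x, y, w] p) (![x, y, w] q) ↔ _
    have e1 : ¬ K.Adj y x := fun h => h6 h.symm
    have e2 := h4.symm
    have e3 := h5.symm
    fin_cases p <;> fin_cases q <;> simp [circOpTwo, h4, h5, h6, e1, e2, e3]

/-- the graph described by a bit matrix -/
def toG (vs : List ℕ) (M : ℕ) : SimpleGraph {a // a ∈ vs} :=
  SimpleGraph.fromRel (fun a b => adjB M a.1 b.1 = true)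

/-- symmetric bit matrices without loops -/
def SyB (M : ℕ) : Prop := ∀ a < 16, ∀ b < 16, adjB M a b = true → adjB M b a = true ∧ a ≠ b

theorem toG_adj {vs : List ℕ} {M : ℕ} (h16 : ∀ a ∈ vs, a < 16) (hM : SyB M) (p q : {a // a ∈ vs}) :
    (toG vs M).Adj p q ↔ adjB M p.1 q.1 = true := by
  have hp := h16 _ p.2
  have hq := h16 _ q.2
  simp only [toG, fromRel_adj]
  constructor
  · rintro ⟨_, h | h⟩
    · exact h
    · exact (hM _ hq _ hp h).1
  · intro h
    exact ⟨fun hh => (hM _ hp _ hq h).2 (congrArg Subtype.val hh), Or.inl h⟩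

theorem SyB.addE {M a b : ℕ} (hM : SyB M) (ha : a < 16) (hb : b < 16) (hab : a ≠ b) :
    SyB (addE M a b) := by
  intro p hp q hq h
  rw [adjB_addE ha hb hp hq] at h
  rw [adjB_addE ha hb hq hp]
  rcases h with h | ⟨rfl, rfl⟩ | ⟨rfl, rfl⟩
  · exact ⟨Or.inl (hM p hp q hq h).1, (hM p hp q hq h).2⟩
  · exact ⟨Or.inr (Or.inr ⟨rfl, rfl⟩), hab⟩
  · exact ⟨Or.inr (Or.inl ⟨rfl, rfl⟩), hab.symm⟩

theorem filt_mem {vs : List ℕ} {p : ℕ → Bool} {l : List ℕ} (h : vs.filter p = l) (b : ℕ) :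
    b ∈ l ↔ b ∈ vs ∧ p b = true := by
  rw [← h, List.mem_filter]

set_option maxHeartbeats 2000000 in
theorem inFB_sound (mv : List Bool) : ∀ (i j : ℕ) (vs : List ℕ) (M : ℕ), vs.Nodup →
    (∀ a ∈ vs, a < 16) → SyB M → inFB mv i j vs M = true → IsInF i j (toG vs M) := by
  induction mv with
  | nil =>
    intro i j vs M hnd h16 hM h
    rw [inFB, Bool.and_eq_true, List.all_eq_true] at h
    obtain ⟨h1, h2⟩ := h
    have htop : toG vs M = ⊤ := by
      ext p q
      rw [toG_adj h16 hM, top_adj]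
      constructor
      · intro h hh
        exact (hM _ (h16 _ p.2) _ (h16 _ q.2) h).2 (congrArg Subtype.val hh)
      · intro h
        have := List.all_eq_true.1 (h2 p.1 p.2) q.1 q.2
        rw [Bool.or_eq_true, Nat.beq_eq] at this
        rcases this with h3 | h3
        · exact absurd (Subtype.ext h3) h
        · exact h3
    have hcard : Fintype.card {a // a ∈ vs} = vs.length := by
      rw [Fintype.card_of_subtype vs.toFinset (by simp), List.toFinset_card_of_nodup hnd]
    rw [htop]
    simp only [Bool.or_eq_true, Bool.and_eq_true, Nat.beq_eq] at h1
    rcases h1 with ⟨⟨hl, rfl⟩, rfl⟩ | ⟨⟨hl, rfl⟩, rfl⟩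
    · have hc : Fintype.card {a // a ∈ vs} = Fintype.card (Fin 3) := by rw [hcard, hl]; simp
      have := IsInF.cycle 3 le_rfl
      rw [cycleGraph_three_eq_top] at this
      exact IsInF.iso ⟨Iso.completeGraph (Fintype.equivOfCardEq hc)⟩ this
    · have hc : Fintype.card {a // a ∈ vs} = Fintype.card (Fin 4) := by rw [hcard, hl]; simp
      exact IsInF.iso ⟨Iso.completeGraph (Fintype.equivOfCardEq hc)⟩ IsInF.k4
  | cons mb mv ih =>
    intro i j vs M hnd h16 hM h
    cases mb with
    | false =>
      rw [inFB, Bool.and_eq_true, List.any_eq_true] at h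
      obtain ⟨hi, x, hx, h⟩ := h
      have hi : i ≠ 0 := by
        rintro rfl; simp at hi
      split at h
      · rename_i a b hab
        rw [Bool.and_eq_true] at h
        obtain ⟨hnab, h⟩ := h
        have hnab : adjB M a b = false := by simpa using hnab
        have hmem := filt_mem hab
        have hnd2 : [a, b].Nodup := hab ▸ hnd.filter _
        have hab' : a ≠ b := by simpa using hnd2
        have ha := (hmem a).1 (by simp)
        have hb := (hmem b).1 (by simp)
        have hx16 := h16 x hx
        have ha16 := h16 a ha.1
        have hb16 := h16 b hb.1
        have hxa := (hM x hx16 a ha16 ha.2).2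
        have hxb := (hM x hx16 b hb16 hb.2).2
        have hM' := hM.addE ha16 hb16 hab'
        have hvm : ∀ c, c ∈ vs.filter (fun v => !(Nat.beq v x)) ↔ c ∈ vs ∧ c ≠ x := by
          intro c
          rw [List.mem_filter, Bool.not_eq_true', Bool.eq_false_iff, Ne, Nat.beq_eq]
        have h16' : ∀ c ∈ vs.filter (fun v => !(Nat.beq v x)), c < 16 :=
          fun c hc => h16 c ((hvm c).1 hc).1
        have hF := ih (i - 1) j _ _ (hnd.filter _) h16' hM' h
        have hav := (hvm a).2 ⟨ha.1, hxa.symm⟩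
        have hbv := (hvm b).2 ⟨hb.1, hxb.symm⟩
        have hadj : (toG (vs.filter fun v => !(Nat.beq v x)) (addE M a b)).Adj ⟨a, hav⟩ ⟨b, hbv⟩ := by
          rw [toG_adj h16' hM', adjB_addE ha16 hb16 ha16 hb16]
          exact Or.inr (Or.inl ⟨rfl, rfl⟩)
        have hF2 := IsInF.subdiv hadj hF
        have e : i - 1 + 1 = i := by omega
        rw [e] at hF2
        refine IsInF.iso (iso_sub (fun p => ⟨p.1, ((hvm _).1 p.2).1⟩) ⟨x, hx⟩ _ _ ?_ ?_ ?_ ?_ ?_) hF2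
        · intro p q hpq
          exact Subtype.ext (Subtype.mk.inj hpq)
        · intro p hp
          exact ((hvm _).1 p.2).2 (congrArg Subtype.val hp)
        · intro c
          by_cases hc : c.1 = x
          · exact Or.inl (Subtype.ext hc)
          · exact Or.inr ⟨⟨c.1, (hvm _).2 ⟨c.2, hc⟩⟩, rfl⟩
        · intro p
          rw [toG_adj h16 hM]
          have := hmem p.1
          simp only [List.mem_cons, List.not_mem_nil, or_false] at this
          rw [Subtype.ext_iff, Subtype.ext_iff, this]
          exact ⟨fun h => ⟨((hvm _).1 p.2).1, h⟩, fun h => h.2⟩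
        · intro p q
          have hp16 := h16' _ p.2
          have hq16 := h16' _ q.2
          rw [toG_adj h16 hM, toG_adj h16' hM', adjB_addE ha16 hb16 hp16 hq16]
          simp only [Ne, Sym2.eq_iff, Subtype.ext_iff]
          constructor
          · intro hpq
            refine ⟨Or.inl hpq, ?_⟩
            rintro (⟨h1, h2⟩ | ⟨h1, h2⟩)
            · rw [h1, h2, hnab] at hpq; exact absurd hpq (by simp)
            · rw [h1, h2] at hpq
              have := (hM b hb16 a ha16 hpq).1
              rw [hnab] at this; exact absurd this (by simp)
          · rintro ⟨h1, h2⟩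
            rcases h1 with h1 | h1
            · exact h1
            · exact absurd h1 h2
      · exact absurd h (by simp)
    | true =>
      rw [inFB, Bool.and_eq_true, List.any_eq_true] at h
      obtain ⟨hj, w, hw, h⟩ := h
      have hj : j ≠ 0 := by
        rintro rfl; simp at hj
      split at h
      · rename_i p q r hpqr
        rw [List.any_eq_true] at h
        obtain ⟨⟨x, y, z⟩, ht, h⟩ := h
        have hmem0 := filt_mem hpqr
        have hnd2 : [p, q, r].Nodup := hpqr ▸ hnd.filter _
        have hd3 : p ≠ q ∧ p ≠ r ∧ q ≠ r := by
          simp only [List.nodup_cons, List.mem_cons, List.not_mem_nil, or_false, not_or] at hnd2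
          tauto
        have hxyz : x ≠ y ∧ x ≠ z ∧ y ≠ z ∧
            ∀ b, (b = x ∨ b = y ∨ b = z) ↔ b ∈ vs ∧ adjB M w b = true := by
          simp only [List.mem_cons, List.not_mem_nil, or_false, Prod.mk.injEq] at ht hmem0
          rcases ht with ⟨rfl, rfl, rfl⟩ | ⟨rfl, rfl, rfl⟩ | ⟨rfl, rfl, rfl⟩
          · exact ⟨hd3.1, hd3.2.1, hd3.2.2, hmem0⟩
          · refine ⟨hd3.2.1, hd3.1, hd3.2.2.symm, fun b => ?_⟩
            rw [← hmem0]; tauto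
          · refine ⟨hd3.2.2, hd3.1.symm, hd3.2.1.symm, fun b => ?_⟩
            rw [← hmem0]; tauto
        clear hmem0 hnd2 hd3 ht hpqr
        obtain ⟨hxy, hxz, hyz, hwm⟩ := hxyz
        rw [Bool.and_eq_true] at h
        obtain ⟨hnxy, h⟩ := h
        have hnxy : adjB M x y = false := by simpa using hnxy
        have hx := (hwm x).1 (by simp)
        have hy := (hwm y).1 (by simp)
        have hz := (hwm z).1 (by simp)
        have hw16 := h16 w hw
        have hx16 := h16 x hx.1
        have hy16 := h16 y hy.1
        have hz16 := h16 z hz.1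
        have hwx := (hM w hw16 x hx16 hx.2).2
        have hwy := (hM w hw16 y hy16 hy.2).2
        have hwz := (hM w hw16 z hz16 hz.2).2
        have hnyx : adjB M y x = false := by
          rw [Bool.eq_false_iff]
          intro hh
          rw [(hM y hy16 x hx16 hh).1] at hnxy
          exact absurd hnxy (by simp)
        have hvw : ∀ c, c ∈ vs.filter (fun v => !(Nat.beq v w)) ↔ c ∈ vs ∧ c ≠ w := by
          intro c
          rw [List.mem_filter, Bool.not_eq_true', Bool.eq_false_iff, Ne, Nat.beq_eq]
        split at h
        · rename_i a b c d hab hcd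
          have hmx := filt_mem hab
          have hmy := filt_mem hcd
          have hab' : a ≠ b := by
            have : [a, b].Nodup := hab ▸ (hnd.filter _).filter _
            simpa using this
          have hcd' : c ≠ d := by
            have : [c, d].Nodup := hcd ▸ (hnd.filter _).filter _
            simpa using this
          simp only [List.mem_cons, List.not_mem_nil, or_false, hvw] at hmx hmy
          simp only [Bool.and_eq_true, Bool.not_eq_true'] at h
          obtain ⟨⟨⟨⟨hnab, hncd⟩, hne1⟩, hne2⟩, hdeg, h⟩ := h
          have hne : ¬ ((a = c ∧ b = d) ∨ (a = d ∧ b = c)) := by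
            rintro (⟨rfl, rfl⟩ | ⟨rfl, rfl⟩)
            · simp at hne1
            · simp at hne2
          have ha := (hmx a).1 (by simp)
          have hb := (hmx b).1 (by simp)
          have hc := (hmy c).1 (by simp)
          have hd := (hmy d).1 (by simp)
          have ha16 := h16 a ha.1.1
          have hb16 := h16 b hb.1.1
          have hc16 := h16 c hc.1.1
          have hd16 := h16 d hd.1.1
          have hM1 := hM.addE ha16 hb16 hab'
          have hM' := hM1.addE hc16 hd16 hcd'
          have hvm : ∀ e, e ∈ (vs.filter fun v => !(Nat.beq v w)).filter (fun v =>
              !(Nat.beq v x) && !(Nat.beq v y)) ↔ e ∈ vs ∧ e ≠ w ∧ e ≠ x ∧ e ≠ y := by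
            intro e
            rw [List.mem_filter, hvw, Bool.and_eq_true, Bool.not_eq_true', Bool.not_eq_true',
              Bool.eq_false_iff, Bool.eq_false_iff]
            simp only [Ne, Nat.beq_eq]
            tauto
          have hndv := (hnd.filter (fun v => !(Nat.beq v w))).filter (fun v =>
              !(Nat.beq v x) && !(Nat.beq v y))
          revert hvm hdeg h hndv
          generalize (vs.filter fun v => !(Nat.beq v w)).filter (fun v =>
              !(Nat.beq v x) && !(Nat.beq v y)) = vs'
          intro hdeg h hvm hndv
          have h16' : ∀ c ∈ vs', c < 16 := fun c hc => h16 c ((hvm c).1 hc).1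
          have hF := ih i (j - 1) _ _ hndv h16' hM' h
          have nexy : ∀ e, adjB M x e = true → e ≠ x ∧ e ≠ y := by
            intro e he
            constructor
            · rintro rfl; exact (hM _ hx16 _ hx16 he).2 rfl
            · rintro rfl; rw [hnxy] at he; exact absurd he (by simp)
          have neyx : ∀ e, adjB M y e = true → e ≠ x ∧ e ≠ y := by
            intro e he
            constructor
            · rintro rfl; rw [hnyx] at he; exact absurd he (by simp)
            · rintro rfl; exact (hM _ hy16 _ hy16 he).2 rfl
          have hav := (hvm a).2 ⟨ha.1.1, ha.1.2, nexy a ha.2⟩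
          have hbv := (hvm b).2 ⟨hb.1.1, hb.1.2, nexy b hb.2⟩
          have hcv := (hvm c).2 ⟨hc.1.1, hc.1.2, neyx c hc.2⟩
          have hdv := (hvm d).2 ⟨hd.1.1, hd.1.2, neyx d hd.2⟩
          have hzv := (hvm z).2 ⟨hz.1, hwz.symm, hxz.symm, hyz.symm⟩
          have hAdj : ∀ p q : {a // a ∈ vs'}, (toG vs' (addE (addE M a b) c d)).Adj p q ↔
              (adjB M p.1 q.1 = true ∨ (p.1 = a ∧ q.1 = b) ∨ (p.1 = b ∧ q.1 = a)) ∨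
              (p.1 = c ∧ q.1 = d) ∨ (p.1 = d ∧ q.1 = c) := by
            intro p q
            have hp16 := h16' _ p.2
            have hq16 := h16' _ q.2
            rw [toG_adj h16' hM', adjB_addE hc16 hd16 hp16 hq16, adjB_addE ha16 hb16 hp16 hq16]
          have hdeg2 : HasDegreeTwo (toG vs' (addE (addE M a b) c d)) ⟨z, hzv⟩ := by
            unfold degTwoB at hdeg
            rw [Nat.beq_eq, List.length_eq_two] at hdeg
            obtain ⟨e, f, hef⟩ := hdeg
            have hm := filt_mem hef
            have hnef : e ≠ f := by
              have : [e, f].Nodup := hef ▸ hndv.filter _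
              simpa using this
            have he := (hm e).1 (by simp)
            have hf := (hm f).1 (by simp)
            refine ⟨⟨e, he.1⟩, ⟨f, hf.1⟩, fun hh => hnef (congrArg Subtype.val hh), ?_, ?_, ?_⟩
            · rw [toG_adj h16' hM']; exact he.2
            · rw [toG_adj h16' hM']; exact hf.2
            · intro g hg
              rw [toG_adj h16' hM'] at hg
              have := (hm g.1).2 ⟨g.2, hg⟩
              simp only [List.mem_cons, List.not_mem_nil, or_false] at this
              rwa [Subtype.ext_iff, Subtype.ext_iff]
          have hF2 := IsInF.op (G := circOpTwo (toG vs' (addE (addE M a b) c d))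
              ⟨a, hav⟩ ⟨b, hbv⟩ ⟨c, hcv⟩ ⟨d, hdv⟩ ⟨z, hzv⟩) hdeg2
            (Or.inl ⟨⟨a, hav⟩, ⟨b, hbv⟩, ⟨c, hcv⟩, ⟨d, hdv⟩, by
              rw [hAdj]; simp, by rw [hAdj]; simp, by
              simp only [Ne, Sym2.eq_iff, Subtype.ext_iff]; exact hne, rfl⟩) hF
          have e : j - 1 + 1 = j := by omega
          rw [e] at hF2
          refine IsInF.iso (iso_op (fun p => ⟨p.1, ((hvm _).1 p.2).1⟩) ⟨x, hx.1⟩ ⟨y, hy.1⟩ ⟨w, hw⟩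
            _ _ _ _ _ ?_ ?_ ?_ ?_ ?_ ?_ ?_ ?_ ?_ ?_ ?_ ?_ ?_ ?_ ?_) hF2
          · intro p q hpq
            exact Subtype.ext (Subtype.mk.inj hpq)
          · intro p hp
            exact ((hvm _).1 p.2).2.2.1 (congrArg Subtype.val hp)
          · intro p hp
            exact ((hvm _).1 p.2).2.2.2 (congrArg Subtype.val hp)
          · intro p hp
            exact ((hvm _).1 p.2).2.1 (congrArg Subtype.val hp)
          · exact fun hh => hxy (congrArg Subtype.val hh)
          · exact fun hh => hwx (congrArg Subtype.val hh).symm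
          · exact fun hh => hwy (congrArg Subtype.val hh).symm
          · intro c
            simp only [Subtype.ext_iff]
            by_cases h1 : c.1 = x
            · exact Or.inl h1
            by_cases h2 : c.1 = y
            · exact Or.inr (Or.inl h2)
            by_cases h3 : c.1 = w
            · exact Or.inr (Or.inr (Or.inl h3))
            · exact Or.inr (Or.inr (Or.inr ⟨⟨c.1, (hvm _).2 ⟨c.2, h3, h1, h2⟩⟩, rfl⟩))
          · intro p
            have hp := (hvm _).1 p.2
            rw [toG_adj h16 hM, Subtype.ext_iff, Subtype.ext_iff]
            rw [hmx p.1]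
            exact ⟨fun h => ⟨⟨hp.1, hp.2.1⟩, h⟩, fun h => h.2⟩
          · intro p
            have hp := (hvm _).1 p.2
            rw [toG_adj h16 hM, Subtype.ext_iff, Subtype.ext_iff]
            rw [hmy p.1]
            exact ⟨fun h => ⟨⟨hp.1, hp.2.1⟩, h⟩, fun h => h.2⟩
          · intro p
            have hp := (hvm _).1 p.2
            rw [toG_adj h16 hM, Subtype.ext_iff]
            constructor
            · intro hh
              rcases (hwm p.1).2 ⟨hp.1, hh⟩ with h1 | h1 | h1
              · exact absurd h1 hp.2.2.1
              · exact absurd h1 hp.2.2.2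
              · exact h1
            · intro hh
              exact ((hwm p.1).1 (Or.inr (Or.inr hh))).2
          · rw [toG_adj h16 hM]; exact hx.2
          · rw [toG_adj h16 hM]; exact hy.2
          · rw [toG_adj h16 hM]; simp [hnxy]
          · intro p q
            rw [toG_adj h16 hM, hAdj]
            simp only [Ne, Sym2.eq_iff, Subtype.ext_iff]
            have hnba : adjB M b a = true → False := by
              intro hh
              rw [(hM b hb16 a ha16 hh).1] at hnab
              exact absurd hnab (by simp)
            have hndc : adjB M d c = true → False := by
              intro hh
              rw [(hM d hd16 c hc16 hh).1] at hncd
              exact absurd hncd (by simp)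
            constructor
            · intro hpq
              refine ⟨Or.inl (Or.inl hpq), ?_, ?_⟩
              · rintro (⟨h1, h2⟩ | ⟨h1, h2⟩)
                · rw [h1, h2, hnab] at hpq; exact absurd hpq (by simp)
                · rw [h1, h2] at hpq
                  exact hnba hpq
              · rintro (⟨h1, h2⟩ | ⟨h1, h2⟩)
                · rw [h1, h2, hncd] at hpq; exact absurd hpq (by simp)
                · rw [h1, h2] at hpq
                  exact hndc hpq
            · rintro ⟨h1, h2, h3⟩
              rcases h1 with (h1 | h1) | h1
              · exact h1
              · exact absurd h1 h2
              · exact absurd h1 h3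
        · exact absurd h (by simp)
      · exact absurd h (by simp)

theorem twoC4_sound {V : Type} [Fintype V] [DecidableEq V] {H : SimpleGraph V} {s : Finset V}
    {M : ℕ} {L : ℕ → V} (hI : SInv H s 8 8 M L) (h : twoC4B M = true) :
    ∃ s1 s2 : Finset V, Disjoint s1 s2 ∧ C4 (res H (s1 : Set V)) ∧ C4 (res H (s2 : Set V)) := by
  unfold twoC4B at h
  simp only [List.any_eq_true, List.mem_range, mem_nbrs, Bool.and_eq_true, Bool.not_eq_true',
    List.contains_eq_mem, decide_eq_false_iff_not, List.mem_cons, List.not_mem_nil, or_false,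
    not_or] at h
  obtain ⟨a, ha, b, ⟨hb, hab⟩, c, ⟨hc, hbc⟩, hac, d, ⟨hd, hcd⟩, ⟨hda, hbd⟩,
    a', ha', na, b', ⟨hb', hab'⟩, nb, c', ⟨hc', hbc'⟩, ⟨nc, hac'⟩, d', ⟨hd', hcd'⟩, ⟨nd, hda'⟩, hbd'⟩ := h
  have key : ∀ a < 8, ∀ b < 8, ∀ c < 8, ∀ d < 8, adjB M a b = true → adjB M b c = true →
      adjB M c d = true → adjB M d a = true → Nat.beq a c = false → Nat.beq b d = false →
      C4 (res H ((({a, b, c, d} : Finset ℕ).image L : Finset V) : Set V)) := by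
    intro a ha b hb c hc d hd h1 h2 h3 h4 h5 h6
    have h1 := (hI.snd a (by omega) b (by omega) h1).2.2.2
    have h2 := (hI.snd b (by omega) c (by omega) h2).2.2.2
    have h3 := (hI.snd c (by omega) d (by omega) h3).2.2.2
    have h4 := (hI.snd d (by omega) a (by omega) h4).2.2.2
    refine ⟨L a, L b, L c, L d, ⟨h1, ?_, ?_⟩, ⟨h2, ?_, ?_⟩, ⟨h3, ?_, ?_⟩, ⟨h4, ?_, ?_⟩, ?_, ?_⟩
    iterate 8 simp
    · intro hh
      have := hI.inj a ha c hc hh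
      subst this
      simp at h5
    · intro hh
      have := hI.inj b hb d hd hh
      subst this
      simp at h6
  refine ⟨({a, b, c, d} : Finset ℕ).image L, ({a', b', c', d'} : Finset ℕ).image L, ?_,
    key a ha b hb c hc d hd hab hbc hcd hda hac hbd,
    key a' ha' b' hb' c' hc' d' hd' hab' hbc' hcd' hda' hac' hbd'⟩
  rw [Finset.disjoint_left]
  intro v h1 h2
  obtain ⟨x, hx, rfl⟩ := Finset.mem_image.1 h1
  obtain ⟨y, hy, hxy⟩ := Finset.mem_image.1 h2
  simp only [Finset.mem_insert, Finset.mem_singleton] at hx hy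
  have hx8 : x < 8 := by
    rcases hx with rfl | rfl | rfl | rfl <;> assumption
  have hy8 : y < 8 := by
    rcases hy with rfl | rfl | rfl | rfl <;> assumption
  have := hI.inj y hy8 x hx8 hxy
  subst this
  clear hab hbc hcd hda hac hbd hab' hbc' hcd' hda' hac' hbd' key
  rcases hy with rfl | rfl | rfl | rfl
  · tauto
  · tauto
  · tauto
  · tauto

theorem iso_toG {V : Type} [Fintype V] [DecidableEq V] {H : SimpleGraph V} {s : Finset V}
    {n M : ℕ} {L : ℕ → V} (hs : s.card = n) (hI : SInv H s n n M L) :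
    SyB M ∧ Nonempty (H.induce (s : Set V) ≃g toG (List.range n) M) := by
  have hk := hI.k16
  have hSy : SyB M := by
    intro a ha b hb h
    have h1 := hI.snd a ha b hb h
    refine ⟨h1.2.2.1, ?_⟩
    rintro rfl
    exact h1.2.2.2.ne rfl
  refine ⟨hSy, ?_⟩
  let F : {a // a ∈ List.range n} → (s : Set V) := fun a => ⟨L a.1, hI.mem _ (List.mem_range.1 a.2)⟩
  have hF : Function.Bijective F := by
    rw [Fintype.bijective_iff_injective_and_card]
    constructor
    · intro a b hab
      exact Subtype.ext (hI.inj _ (List.mem_range.1 a.2) _ (List.mem_range.1 b.2)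
        (congrArg Subtype.val hab))
    · rw [Fintype.card_of_subtype (List.range n).toFinset (by simp),
        List.toFinset_card_of_nodup List.nodup_range, List.length_range]
      simp [hs]
  refine ⟨RelIso.symm ⟨Equiv.ofBijective F hF, ?_⟩⟩
  intro a b
  have ha := List.mem_range.1 a.2
  have hb := List.mem_range.1 b.2
  rw [toG_adj (fun c hc => lt_trans (List.mem_range.1 hc) hk) hSy]
  show H.Adj (L a.1) (L b.1) ↔ _
  constructor
  · intro h
    obtain ⟨c, hc, hc1, hc2⟩ := hI.full _ ha _ h
    rw [hI.inj _ hb _ hc hc1]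
    exact hc2
  · intro h
    exact (hI.snd _ (by omega) _ (by omega) h).2.2.2

theorem run8 : searchB 8 false twoC4B 9 0 1 4 (addAll 0 0 [1,2,3]) = true := by decide +kernel
theorem run10 : searchB 10 true (inFB [true,false,false,false] 4 2 (List.range 10)) 11 1 1 3
    (addAll 0 0 [1,2]) = true := by decide +kernel
theorem run13 : searchB 13 true (inFB [true,true,true,false] 4 3 (List.range 13)) 14 0 1 3
    (addAll 0 0 [1,2]) = true := by decide +kernel

theorem case8 {V : Type} [Fintype V] [DecidableEq V] {H : SimpleGraph V} {s : Finset V}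
    (hs : s.card = 8) (hc : ConnOn H s) (hd : ∀ v ∈ s, dg H v = 3)
    (htri : ∀ a b c, H.Adj a b → H.Adj b c → H.Adj a c → False) :
    ∃ s1 s2 : Finset V, Disjoint s1 s2 ∧ C4 (res H (s1 : Set V)) ∧ C4 (res H (s2 : Set V)) := by
  obtain ⟨v, hv⟩ := hc.1
  obtain ⟨L, hI, hL⟩ := search_start (by omega) hc hv
  rw [hd v hv] at hI
  obtain ⟨M', L', hI', hf⟩ := search_sound hs (by omega) hc
    (fun v hv => by rw [hd v hv]; omega) htri (g := false) (by simp) _ _ _ _ _ L hI (by omega) (by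
      apply le_of_eq
      apply Finset.sum_eq_zero
      intro v hv
      rw [hd v (Finset.mem_sdiff.1 hv).1]; rfl) run8
  exact twoC4_sound hI' hf

theorem case_root {V : Type} [Fintype V] [DecidableEq V] {H : SimpleGraph V} {s : Finset V} {n q : ℕ}
    (hs : s.card = n) (hn : n < 16) (hc : ConnOn H s) (hd : ∀ v ∈ s, 2 ≤ dg H v ∧ dg H v ≤ 3)
    (htri : ∀ a b c, H.Adj a b → H.Adj b c → H.Adj a c → False) (h4 : ¬ C4 H)
    (hq : ∑ v ∈ s, (3 - dg H v) = q + 1) {fin : ℕ → Bool} {f : ℕ}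
    (hrun : searchB n true fin f q 1 3 (addAll 0 0 [1,2]) = true) :
    ∃ M' L', SInv H s n n M' L' ∧ fin M' = true := by
  have hex : ∃ v ∈ s, dg H v = 2 := by
    by_contra hcon
    push Not at hcon
    rw [Finset.sum_eq_zero] at hq
    · omega
    · intro v hv
      have := hd v hv
      have := hcon v hv
      omega
  obtain ⟨v, hv, hv2⟩ := hex
  obtain ⟨L, hI, hL⟩ := search_start (by omega) hc hv
  rw [hv2] at hI
  refine search_sound hs hn hc hd htri (g := true) (fun _ => h4) _ _ _ _ _ L hI (by omega) ?_ hrun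
  have h1 : (Finset.range 1).image L = {v} := by simp [hL]
  rw [h1, Finset.sdiff_singleton_eq_erase]
  have := Finset.add_sum_erase s (fun v => 3 - dg H v) hv
  omega

theorem case10 {V : Type} [Fintype V] [DecidableEq V] {H : SimpleGraph V} {s : Finset V}
    (hs : s.card = 10) (hc : ConnOn H s) (hd : ∀ v ∈ s, 2 ≤ dg H v ∧ dg H v ≤ 3)
    (htri : ∀ a b c, H.Adj a b → H.Adj b c → H.Adj a c → False) (h4 : ¬ C4 H)
    (hq : ∑ v ∈ s, (3 - dg H v) = 2) : IsInF 4 2 (H.induce (s : Set V)) := by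
  obtain ⟨M, L, hI, hf⟩ := case_root hs (by omega) hc hd htri h4 hq run10
  obtain ⟨hSy, he⟩ := iso_toG hs hI
  exact IsInF.iso he (inFB_sound _ _ _ _ _ List.nodup_range
    (fun c hc => lt_trans (List.mem_range.1 hc) (by omega)) hSy hf)

theorem case13 {V : Type} [Fintype V] [DecidableEq V] {H : SimpleGraph V} {s : Finset V}
    (hs : s.card = 13) (hc : ConnOn H s) (hd : ∀ v ∈ s, 2 ≤ dg H v ∧ dg H v ≤ 3)
    (htri : ∀ a b c, H.Adj a b → H.Adj b c → H.Adj a c → False) (h4 : ¬ C4 H)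
    (hq : ∑ v ∈ s, (3 - dg H v) = 1) : IsInF 4 3 (H.induce (s : Set V)) := by
  obtain ⟨M, L, hI, hf⟩ := case_root hs (by omega) hc hd htri h4 hq run13
  obtain ⟨hSy, he⟩ := iso_toG hs hI
  exact IsInF.iso he (inFB_sound _ _ _ _ _ List.nodup_range
    (fun c hc => lt_trans (List.mem_range.1 hc) (by omega)) hSy hf)

theorem dg_eq {V : Type} [Fintype V] (H : SimpleGraph V) (v : V) :
    dg H v = (H.neighborSet v).ncard := by
  classical
  unfold dg
  rw [← Set.ncard_coe_finset]
  congr 1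
  ext w
  simp [mem_nb]

theorem dg_le {V : Type} [Fintype V] {H : SimpleGraph V} (h : Sub3 H) (v : V) : dg H v ≤ 3 := by
  rw [dg_eq]; exact h v

theorem dg_sum {V : Type} [Fintype V] [DecidableEq V] {H : SimpleGraph V} {s : Finset V}
    (hin : ∀ u v, H.Adj u v → u ∈ s ∧ v ∈ s) : ∑ v ∈ s, dg H v = 2 * H.edgeSet.ncard := by
  classical
  have h1 := H.sum_degrees_eq_twice_card_edges
  have h2 : H.edgeSet.ncard = H.edgeFinset.card := by
    rw [← coe_edgeFinset, Set.ncard_coe_finset]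
  rw [h2, ← h1]
  rw [← Finset.sum_subset (Finset.subset_univ s)]
  · apply Finset.sum_congr rfl
    intro v _
    rw [dg_eq, ← card_neighborFinset_eq_degree, ← Set.ncard_coe_finset, coe_neighborFinset]
  · intro v _ hv
    rw [← card_neighborFinset_eq_degree, Finset.card_eq_zero, Finset.eq_empty_iff_forall_notMem]
    intro w hw
    exact hv (hin _ _ ((mem_neighborFinset _ _ _).1 hw)).1

theorem sum_nb {V : Type} [Fintype V] [DecidableEq V] {H : SimpleGraph V} {s : Finset V}
    (hin : ∀ u v, H.Adj u v → u ∈ s ∧ v ∈ s) :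
    ∑ a ∈ s, ∑ u ∈ nb H a, dg H u = ∑ u ∈ s, dg H u * dg H u := by
  rw [Finset.sum_comm' (t' := s) (s' := fun u => nb H u)]
  · apply Finset.sum_congr rfl
    intro u _
    rw [Finset.sum_const, smul_eq_mul]
    rfl
  · intro x y
    rw [mem_nb, mem_nb]
    exact ⟨fun h => ⟨h.2.symm, (hin _ _ h.2).2⟩, fun h => ⟨(hin _ _ h.1).2, h.1.symm⟩⟩

theorem q_c4 {V : Type} [Fintype V] [DecidableEq V] {H : SimpleGraph V} {s : Finset V}
    (hin : ∀ u v, H.Adj u v → u ∈ s ∧ v ∈ s)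
    (htri : ∀ a b c, H.Adj a b → H.Adj b c → H.Adj a c → False) (h4 : ¬ C4 H) :
    ∑ u ∈ s, dg H u * dg H u + s.card ≤ s.card * s.card := by
  rw [← sum_nb hin]
  have key : ∀ a ∈ s, ∑ u ∈ nb H a, dg H u + 1 ≤ s.card := by
    intro a ha
    have hdisj : ((nb H a : Finset V) : Set V).PairwiseDisjoint (fun u => (nb H u).erase a) := by
      intro u hu v hv huv
      have hu := mem_nb.1 (Finset.mem_coe.1 hu)
      have hv := mem_nb.1 (Finset.mem_coe.1 hv)
      rw [Function.onFun, Finset.disjoint_left]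
      intro w h1 h2
      rw [Finset.mem_erase, mem_nb] at h1 h2
      exact h4 ⟨a, u, w, v, hu, h1.2, h2.2.symm, hv.symm, h1.1.symm, huv⟩
    have hd2 : Disjoint ((nb H a).biUnion (fun u => (nb H u).erase a)) (insert a (nb H a)) := by
      rw [Finset.disjoint_left]
      intro w h1 h2
      obtain ⟨u, hu, hw⟩ := Finset.mem_biUnion.1 h1
      rw [Finset.mem_erase, mem_nb] at hw
      rw [mem_nb] at hu
      rcases Finset.mem_insert.1 h2 with rfl | h2
      · exact hw.1 rfl
      · exact htri _ _ _ hu hw.2 (mem_nb.1 h2)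
    have hsub : ((nb H a).biUnion (fun u => (nb H u).erase a)) ∪ (insert a (nb H a)) ⊆ s := by
      intro w hw
      rcases Finset.mem_union.1 hw with h1 | h2
      · obtain ⟨u, hu, hw⟩ := Finset.mem_biUnion.1 h1
        rw [Finset.mem_erase, mem_nb] at hw
        exact (hin _ _ hw.2).2
      · rcases Finset.mem_insert.1 h2 with rfl | h2
        · exact ha
        · exact (hin _ _ (mem_nb.1 h2)).2
    have hcard := Finset.card_le_card hsub
    rw [Finset.card_union_of_disjoint hd2, Finset.card_biUnion hdisj,
      Finset.card_insert_of_notMem (by rw [mem_nb]; exact fun h => h.ne rfl)] at hcard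
    have : ∑ u ∈ nb H a, dg H u = ∑ u ∈ nb H a, ((nb H u).erase a).card + (nb H a).card := by
      rw [Finset.card_eq_sum_ones, ← Finset.sum_add_distrib]
      apply Finset.sum_congr rfl
      intro u hu
      rw [Finset.card_erase_add_one]
      · rfl
      · rw [mem_nb] at hu ⊢; exact hu.symm
    omega
  calc _ = ∑ a ∈ s, (∑ u ∈ nb H a, dg H u + 1) := by
        rw [Finset.sum_add_distrib, ← Finset.card_eq_sum_ones]
    _ ≤ ∑ a ∈ s, s.card := Finset.sum_le_sum key
    _ = _ := by rw [Finset.sum_const, smul_eq_mul]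

theorem q_tri {V : Type} [Fintype V] [DecidableEq V] {H : SimpleGraph V} {s : Finset V}
    (hin : ∀ u v, H.Adj u v → u ∈ s ∧ v ∈ s)
    (htri : ∀ a b c, H.Adj a b → H.Adj b c → H.Adj a c → False) :
    ∑ u ∈ s, dg H u * dg H u ≤ H.edgeSet.ncard * s.card := by
  have key : ∀ a ∈ s, ∑ u ∈ nb H a, dg H u + dg H a * dg H a ≤ dg H a * s.card := by
    intro a ha
    have h1 : ∑ u ∈ nb H a, dg H u + dg H a * dg H a = ∑ u ∈ nb H a, (dg H u + dg H a) := by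
      rw [Finset.sum_add_distrib, Finset.sum_const, smul_eq_mul]
      rfl
    have h2 : dg H a * s.card = ∑ u ∈ nb H a, s.card := by
      rw [Finset.sum_const, smul_eq_mul]
      rfl
    rw [h1, h2]
    apply Finset.sum_le_sum
    intro u hu
    rw [mem_nb] at hu
    have hd : Disjoint (nb H u) (nb H a) := by
      rw [Finset.disjoint_left]
      intro w h1 h2
      exact htri _ _ _ hu (mem_nb.1 h1) (mem_nb.1 h2)
    unfold dg
    rw [← Finset.card_union_of_disjoint hd]
    apply Finset.card_le_card
    intro w hw
    rcases Finset.mem_union.1 hw with h | h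
    · exact (hin _ _ (mem_nb.1 h)).2
    · exact (hin _ _ (mem_nb.1 h)).2
  have h1 := Finset.sum_le_sum key
  rw [Finset.sum_add_distrib, sum_nb hin, ← Finset.sum_mul, dg_sum hin] at h1
  nlinarith

theorem q_low {V : Type} [Fintype V] [DecidableEq V] {H : SimpleGraph V} {s : Finset V}
    (hin : ∀ u v, H.Adj u v → u ∈ s ∧ v ∈ s) :
    12 * H.edgeSet.ncard ≤ ∑ u ∈ s, dg H u * dg H u + 9 * s.card ∧
    8 * H.edgeSet.ncard ≤ ∑ u ∈ s, dg H u * dg H u + 4 * s.card := by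
  have h := dg_sum hin
  constructor
  · have : ∑ u ∈ s, 6 * dg H u ≤ ∑ u ∈ s, (dg H u * dg H u + 9) := by
      apply Finset.sum_le_sum
      intro u _
      nlinarith [sq_nonneg ((dg H u : ℤ) - 3)]
    rw [← Finset.mul_sum, Finset.sum_add_distrib, Finset.sum_const, smul_eq_mul] at this
    omega
  · have : ∑ u ∈ s, 4 * dg H u ≤ ∑ u ∈ s, (dg H u * dg H u + 4) := by
      apply Finset.sum_le_sum
      intro u _
      nlinarith [sq_nonneg ((dg H u : ℤ) - 2)]
    rw [← Finset.mul_sum, Finset.sum_add_distrib, Finset.sum_const, smul_eq_mul] at this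
    omega

theorem arith_one {n m ν q : ℕ} (hm : 2 * m ≤ 3 * n) (hν : m ≤ n + 2 * ν)
    (h1 : 12 * m ≤ q + 9 * n) (h2 : 8 * m ≤ q + 4 * n) (h3 : q ≤ m * n) (hn : n ≤ m + 1) (hn0 : 1 ≤ n)
    (hbad : 6 * n + 7 * ν + 2 < 5 * m + 5) : n = 8 ∧ m = 12 := by
  have hn : n ≤ 16 := by omega
  interval_cases n <;> omega

theorem arith_zero {n m ν q : ℕ} (hm : 2 * m ≤ 3 * n) (hν : m ≤ n + 2 * ν)
    (h1 : 12 * m ≤ q + 9 * n) (h2 : 8 * m ≤ q + 4 * n) (h3 : q + n ≤ n * n) (hn : n ≤ m + 1)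
    (hn0 : 1 ≤ n) (hbad : 6 * n + 7 * ν < 5 * m + 5) :
    2 * m = 3 * n ∨ (n = 10 ∧ m = 14) ∨ (n = 13 ∧ m = 19) := by
  have hn : n ≤ 16 := by omega
  interval_cases n <;> omega

theorem min_dg {V : Type} [Fintype V] [DecidableEq V] {H : SimpleGraph V} {s : Finset V}
    (hc : ConnOn H s) (hb : ∀ e ∈ H.edgeSet, ConnOn (H.deleteEdges {e}) s) (h1 : 1 < s.card)
    {v : V} (hv : v ∈ s) : 2 ≤ dg H v := by
  have hnbr : ∀ (K : SimpleGraph V) (w : V), v ≠ w → K.Reachable v w → ∃ x, K.Adj v x := by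
    intro K w hvw hr
    obtain ⟨p⟩ := hr
    cases p with
    | nil => exact absurd rfl hvw
    | cons h _ => exact ⟨_, h⟩
  obtain ⟨w, hw, hwv⟩ := Finset.exists_mem_ne h1 v
  obtain ⟨x, hx⟩ := hnbr H w hwv.symm (hc.2.2 v hv w hw)
  have hc2 := hb s(v, x) hx
  obtain ⟨y, hy⟩ := hnbr _ x hx.ne (hc2.2.2 v hv x (hc.2.1 _ _ hx).2)
  rw [deleteEdges_adj] at hy
  have hxy : x ≠ y := by
    rintro rfl
    exact hy.2 rfl
  have hsub : {x, y} ⊆ nb H v := by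
    intro z hz
    rw [Finset.mem_insert, Finset.mem_singleton] at hz
    rcases hz with rfl | rfl
    · exact mem_nb.2 hx
    · exact mem_nb.2 hy.1
  have := Finset.card_le_card hsub
  rw [Finset.card_pair hxy] at this
  exact this

theorem all_three {V : Type} [Fintype V] [DecidableEq V] {H : SimpleGraph V} {s : Finset V}
    (hin : ∀ u v, H.Adj u v → u ∈ s ∧ v ∈ s) (hH : Sub3 H)
    (h : 2 * H.edgeSet.ncard = 3 * s.card) : ∀ v ∈ s, dg H v = 3 := by
  intro v hv
  by_contra hne
  have hlt : ∑ u ∈ s, dg H u < ∑ u ∈ s, 3 :=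
    Finset.sum_lt_sum (fun u _ => dg_le hH u) ⟨v, hv, lt_of_le_of_ne (dg_le hH v) hne⟩
  rw [dg_sum hin, Finset.sum_const, smul_eq_mul] at hlt
  omega

theorem closed_univ {V : Type} [Fintype V] [DecidableEq V] {G H : SimpleGraph V} {s : Finset V}
    (hG : Sub3 G) (hconn : G.Connected) (hle : H ≤ G) (hne : s.Nonempty)
    (hin : ∀ u v, H.Adj u v → u ∈ s ∧ v ∈ s)
    (h : 2 * H.edgeSet.ncard = 3 * s.card) : s = Finset.univ := by
  have h3 := all_three hin (Sub3.mono hle hG) h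
  have hcl : ∀ u ∈ s, ∀ v, G.Adj u v → v ∈ s := by
    intro u hu v huv
    have hsub : nb H u ⊆ nb G u := fun w hw => mem_nb.2 (hle (mem_nb.1 hw))
    have heq : nb H u = nb G u := by
      apply Finset.eq_of_subset_of_card_le hsub
      have h1 := h3 u hu
      have h2 := dg_le hG u
      unfold dg at h1 h2
      omega
    have : v ∈ nb H u := by rw [heq]; exact mem_nb.2 huv
    exact (hin _ _ (mem_nb.1 this)).2
  have hwalk : ∀ u v, G.Walk u v → u ∈ s → v ∈ s := by
    intro u v w
    induction w with
    | nil => exact id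
    | cons h _ ih => intro hu; exact ih (hcl _ hu _ h)
  obtain ⟨u, hu⟩ := hne
  rw [Finset.eq_univ_iff_forall]
  intro v
  obtain ⟨w⟩ := hconn.preconnected u v
  exact hwalk u v w hu

theorem supp_in {V : Type} {H : SimpleGraph V} {s : Finset V}
    (hin : ∀ u v, H.Adj u v → u ∈ s ∧ v ∈ s) {u v : V} (p : H.Walk u v) (hu : u ∈ s) :
    ∀ x ∈ p.support, x ∈ s := by
  induction p with
  | nil => intro x hx; simp only [Walk.support_nil, List.mem_singleton] at hx; exact hx ▸ hu
  | cons h p ih =>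
    intro x hx
    rw [Walk.support_cons, List.mem_cons] at hx
    rcases hx with rfl | hx
    · exact hu
    · exact ih (hin _ _ h).2 x hx

theorem girth_ge {V : Type} [Fintype V] [DecidableEq V] {H : SimpleGraph V} {s : Finset V}
    (hc : ConnOn H s) (hb : ∀ e ∈ H.edgeSet, ConnOn (H.deleteEdges {e}) s)
    (hm : 0 < H.edgeSet.ncard)
    (htri : ∀ a b c, H.Adj a b → H.Adj b c → H.Adj a c → False) (h4 : ¬ C4 H) :
    5 ≤ (H.induce (s : Set V)).girth := by
  have hna : ¬ (H.induce (s : Set V)).IsAcyclic := by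
    obtain ⟨e, he⟩ := (Set.ncard_pos).1 hm
    induction e with
    | h v w =>
      have hadj : H.Adj v w := he
      have hvw := hc.2.1 _ _ hadj
      have hr := (hb _ he).2.2 v hvw.1 w hvw.2
      obtain ⟨u, p, hp, _⟩ := adj_and_reachable_delete_edges_iff_exists_cycle.1 ⟨hadj, hr⟩
      have hu : u ∈ s := (hc.2.1 _ _ (p.adj_snd hp.not_nil)).1
      have hsup := supp_in hc.2.1 p hu
      intro hac
      have hcyc : (p.induce (s : Set V) hsup).IsCycle := by
        apply Walk.IsCycle.of_map (f := (Embedding.induce (s : Set V)).toHom)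
        rw [Walk.map_induce]
        exact hp
      exact hac _ hcyc
  obtain ⟨a, w, hw, hl⟩ := exists_girth_eq_length.2 hna
  rw [hl]
  have h3 := hw.three_le_length
  by_contra hlt
  have hadj : ∀ i, i < w.length → H.Adj (w.getVert i).1 (w.getVert (i + 1)).1 :=
    fun i hi => w.adj_getVert_succ hi
  have h0 : w.getVert 0 = a := w.getVert_zero
  have hend : w.getVert w.length = a := w.getVert_length
  have hinj := hw.getVert_injOn
  rcases (by omega : w.length = 3 ∨ w.length = 4) with h | h
  · rw [h] at hend
    have e0 := hadj 0 (by omega)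
    have e1 := hadj 1 (by omega)
    have e2 := hadj 2 (by omega)
    simp only [Nat.reduceAdd] at e0 e1 e2
    rw [h0] at e0
    rw [hend] at e2
    exact htri _ _ _ e0 e1 e2.symm
  · rw [h] at hend
    have e0 := hadj 0 (by omega)
    have e1 := hadj 1 (by omega)
    have e2 := hadj 2 (by omega)
    have e3 := hadj 3 (by omega)
    simp only [Nat.reduceAdd] at e0 e1 e2 e3
    rw [h0] at e0
    rw [hend] at e3
    refine h4 ⟨_, _, _, _, e0, e1, e2, e3, ?_, ?_⟩
    · intro hh
      have hh : w.getVert 4 = w.getVert 2 := by rw [hend]; exact Subtype.ext hh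
      have := hinj (show 4 ∈ {i | 1 ≤ i ∧ i ≤ w.length} from ⟨by omega, by omega⟩)
        (show 2 ∈ {i | 1 ≤ i ∧ i ≤ w.length} from ⟨by omega, by omega⟩) hh
      omega
    · intro hh
      have hh : w.getVert 1 = w.getVert 3 := Subtype.ext hh
      have := hinj (show 1 ∈ {i | 1 ≤ i ∧ i ≤ w.length} from ⟨by omega, by omega⟩)
        (show 3 ∈ {i | 1 ≤ i ∧ i ≤ w.length} from ⟨by omega, by omega⟩) hh
      omega

theorem crit {V : Type} [Fintype V] [DecidableEq V] {G : SimpleGraph V} (hconn : G.Connected)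
    (hG : Sub3 G) (htri : ∀ a b c, G.Adj a b → G.Adj b c → G.Adj a c → False)
    (hND : ∀ s1 s2 : Finset V, Disjoint s1 s2 → C4 (res G s1) → C4 (res G s2) → False)
    (hF : ∀ (W : Type) (H : SimpleGraph W), InFamilyF H → ¬ ContainsInducedSubdivision G H)
    (H : SimpleGraph V) (s : Finset V) (ν : ℕ) (hle : H ≤ G) (hc : ConnOn H s)
    (hb : ∀ e ∈ H.edgeSet, ConnOn (H.deleteEdges {e}) s)
    (hν : H.edgeSet.ncard ≤ s.card + 2 * ν) :
    5 * H.edgeSet.ncard + 5 ≤ 6 * s.card + 7 * ν + 2 * sg H s := by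
  by_contra hcon
  have hbad := not_le.1 hcon
  have hH := Sub3.mono hle hG
  have htriH : ∀ a b c, H.Adj a b → H.Adj b c → H.Adj a c → False :=
    fun a b c h1 h2 h3 => htri a b c (hle h1) (hle h2) (hle h3)
  have hsum := dg_sum hc.2.1
  have hle3 : ∀ K : SimpleGraph V, K ≤ G → (∀ u v, K.Adj u v → u ∈ s ∧ v ∈ s) →
      2 * K.edgeSet.ncard ≤ 3 * s.card := by
    intro K hK hin
    rw [← dg_sum hin, mul_comm, ← smul_eq_mul, ← Finset.sum_const]
    exact Finset.sum_le_sum (fun u _ => dg_le (Sub3.mono hK hG) u)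
  have hm3 := hle3 H hle hc.2.1
  have hbt := bt_eq hc
  have hnm : s.card ≤ H.edgeSet.ncard + 1 := by omega
  have hn0 : 1 ≤ s.card := Finset.card_pos.2 hc.1
  obtain ⟨hq1, hq2⟩ := q_low hc.2.1
  by_cases hsg : s = Finset.univ ∨ C4 H
  · have hs1 : sg H s = 1 := by unfold sg; rw [if_pos hsg]
    rw [hs1] at hbad
    obtain ⟨hn, hm⟩ := arith_one hm3 hν hq1 hq2 (q_tri hc.2.1 htriH) hnm hn0 (by omega)
    obtain ⟨s1, s2, hd, h1, h2⟩ := case8 hn hc (all_three hc.2.1 hH (by omega)) htriH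
    exact hND s1 s2 hd (h1.mono (res_mono hle _)) (h2.mono (res_mono hle _))
  · have hs0 : sg H s = 0 := by unfold sg; rw [if_neg hsg]
    rw [hs0] at hbad
    push Not at hsg
    obtain ⟨hnu, h4⟩ := hsg
    have hcase := arith_zero hm3 hν hq1 hq2 (q_c4 hc.2.1 htriH h4) hnm hn0 (by omega)
    have hcl : ∀ K : SimpleGraph V, K ≤ G → (∀ u v, K.Adj u v → u ∈ s ∧ v ∈ s) →
        2 * K.edgeSet.ncard = 3 * s.card → False :=
      fun K hK hin h => hnu (closed_univ hG hconn hK hc.1 hin h)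
    rcases hcase with h | h
    · exact hcl H hle hc.2.1 h
    have hn1 : 1 < s.card := by omega
    have hdeg : ∀ v ∈ s, 2 ≤ dg H v ∧ dg H v ≤ 3 :=
      fun v hv => ⟨min_dg hc hb hn1 hv, dg_le hH v⟩
    have hdef : ∑ v ∈ s, (3 - dg H v) + ∑ v ∈ s, dg H v = 3 * s.card := by
      rw [← Finset.sum_add_distrib, mul_comm, ← smul_eq_mul, ← Finset.sum_const]
      apply Finset.sum_congr rfl
      intro v hv
      have := (hdeg v hv).2
      omega
    have hind : H = res G (s : Set V) := by
      by_contra hne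
      have hleK : H ≤ res G (s : Set V) := fun a b hab => ⟨hle hab, hc.2.1 a b hab⟩
      have hlt : H.edgeSet ⊂ (res G (s : Set V)).edgeSet :=
        edgeSet_ssubset_edgeSet.2 (lt_of_le_of_ne hleK hne)
      have hcard := Set.ncard_lt_ncard hlt (Set.toFinite _)
      have hin : ∀ u v, (res G (s : Set V)).Adj u v → u ∈ s ∧ v ∈ s := fun u v h => h.2
      have h1 := hle3 _ (res_le G _) hin
      have h2 := hcl _ (res_le G _) hin
      rcases h with ⟨hn, hm⟩ | ⟨hn, hm⟩
      · exact h2 (by omega)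
      · omega
    have hii : H.induce (s : Set V) = G.induce (s : Set V) := by
      ext a b
      show H.Adj a.1 b.1 ↔ G.Adj a.1 b.1
      constructor
      · exact fun h => hle h
      · intro h
        rw [hind]
        exact ⟨h, a.2, b.2⟩
    have hg := girth_ge hc hb (by omega) htriH h4
    have hfin : (IsInF 4 2 (H.induce (s : Set V)) ∨ IsInF 4 3 (H.induce (s : Set V))) → False := by
      intro hh
      rw [hii] at hh hg
      exact hF _ _ (Or.inl ⟨hh, hg⟩) ⟨(s : Set V), _, _, IsSubdivisionOf.refl _, ⟨Iso.refl⟩⟩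
    rcases h with ⟨hn, hm⟩ | ⟨hn, hm⟩
    · exact hfin (Or.inl (case10 hn hc hdeg htriH h4 (by omega)))
    · exact hfin (Or.inr (case13 hn hc hdeg htriH h4 (by omega)))

theorem c4_cycle {V : Type} {G : SimpleGraph V} {s : Finset V} (h : C4 (res G (s : Set V))) :
    ∃ (u : V) (c : G.Walk u u), c.IsCycle ∧ c.length < 5 ∧ ∀ x ∈ c.support, x ∈ s := by
  obtain ⟨a, b, c, d, h1, h2, h3, h4, h5, h6⟩ := h
  refine ⟨a, Walk.cons h1.1 (Walk.cons h2.1 (Walk.cons h3.1 (Walk.cons h4.1 Walk.nil))), ?_, ?_, ?_⟩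
  · have e1 := h1.1.ne
    have e2 := h2.1.ne
    have e3 := h3.1.ne
    have e4 := h4.1.ne
    rw [Walk.cons_isCycle_iff]
    simp [Walk.cons_isPath_iff]
    grind
  · simp
  · intro x hx
    simp at hx
    have m1 := h1.2.1
    have m2 := h2.2.1
    have m3 := h3.2.1
    have m4 := h4.2.1
    rcases hx with rfl | rfl | rfl | rfl | rfl <;> assumption

/-- If `G` is a finite connected subcubic triangle-free simple graph on `n`
vertices and `m` edges with no two vertex-disjoint cycles each of length less than five and
no induced subdivision of any member of `𝓕`, then `φ(G) ≤ (2m − n + 4)/7`. -/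
theorem statement_14 {V : Type} [Fintype V] (G : SimpleGraph V) (hconn : G.Connected)
    (hsub : ∀ v : V, (G.neighborSet v).ncard ≤ 3)
    (htri : ∀ (u : V) (c : G.Walk u u), c.IsCycle → c.length ≠ 3)
    (hcyc : ¬ HasTwoDisjointShortCycles G)
    (hF : ∀ (W : Type) (H : SimpleGraph W), InFamilyF H → ¬ ContainsInducedSubdivision G H) :
    (phi G : ℝ) ≤ (2 * (G.edgeSet.ncard : ℝ) - (Nat.card V : ℝ) + 4) / 7 := by
  classical
  have htri' : ∀ a b c, G.Adj a b → G.Adj b c → G.Adj a c → False := by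
    intro a b c h1 h2 h3
    refine htri a (Walk.cons h1 (Walk.cons h2 (Walk.cons h3.symm Walk.nil))) ?_ (by simp)
    have e1 := h1.ne
    have e2 := h2.ne
    have e3 := h3.ne
    rw [Walk.cons_isCycle_iff]
    simp [Walk.cons_isPath_iff]
    grind
  have hND : ∀ s1 s2 : Finset V, Disjoint s1 s2 → C4 (res G s1) → C4 (res G s2) → False := by
    intro s1 s2 hd h1 h2
    obtain ⟨u, c1, hc1, hl1, hs1⟩ := c4_cycle h1
    obtain ⟨v, c2, hc2, hl2, hs2⟩ := c4_cycle h2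
    exact hcyc ⟨u, v, c1, c2, hc1, hc2, hl1, hl2, fun x hx hx2 =>
      Finset.disjoint_left.1 hd (hs1 x hx) (hs2 x hx2)⟩
  have hcO : ConnOn G Finset.univ := by
    obtain ⟨v⟩ := hconn.nonempty
    exact ⟨⟨v, Finset.mem_univ v⟩, fun _ _ _ => ⟨Finset.mem_univ _, Finset.mem_univ _⟩,
      fun u _ v _ => hconn.preconnected u v⟩
  obtain ⟨X, hX, hXi⟩ := main_ind hsub hND (crit hconn hsub htri' hND hF) _ G Finset.univ rfl
    le_rfl hcO
  have hsg : sg G Finset.univ = 1 := by unfold sg; rw [if_pos (Or.inl rfl)]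
  have h1 := phi_le hX
  have h2 := bt_eq hcO
  rw [hsg] at hXi
  have h3 : (Finset.univ : Finset V).card = Nat.card V := by
    rw [Finset.card_univ, Nat.card_eq_fintype_card]
  rw [h3] at hXi h2
  rw [le_div_iff₀ (by norm_num)]
  have h1' : (phi G : ℝ) + X.card ≤ bt G := by exact_mod_cast h1
  have h2' : (bt G : ℝ) + Nat.card V = G.edgeSet.ncard + 1 := by exact_mod_cast h2
  have h3' : 5 * (G.edgeSet.ncard : ℝ) + 5 ≤ 6 * Nat.card V + 7 * X.card + 2 * 1 := by
    exact_mod_cast hXi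
  linarith
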